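/- arXiv:math/0403406 — 2 statements merged into one kernel-verified Lean document; each statement's English description precedes it below -/
import Mathlib

section
/- Let h be a Brouwer homeomorphism and let C be a compact subset of the plane. Then the topological limit superior of the sequence (h^n(C))_{n ≥ 0} does not contain C. -/
open Set Filter Topology

/-- The plane. -/
abbrev Plane : Type := ℝ × ℝ

/-- A homeomorphism of the plane preserves orientation iff it is isotopic to the identity. -/
def IsotopicToId (h : Plane ≃ₜ Plane) : Prop :=
  ∃ H : ℝ → Plane ≃ₜ Plane,
    Continuous (fun p : ℝ × Plane => H p.1 p.2) ∧
    H 0 = Homeomorph.refl Plane ∧ H 1 = h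

/-- A Brouwer homeomorphism: an orientation-preserving (i.e. isotopic to the identity),
fixed-point-free homeomorphism of the plane. -/
structure BrouwerHomeo where
  toHomeomorph : Plane ≃ₜ Plane
  orientationPreserving : IsotopicToId toHomeomorph
  fixedPointFree : ∀ x : Plane, toHomeomorph x ≠ x

/-- The integer iterate `h^n`. -/
def BrouwerHomeo.iter (h : BrouwerHomeo) (n : ℤ) : Plane → Plane :=
  ⇑(h.toHomeomorph.toEquiv ^ n)

/-- A set is free if it is disjoint from its image under `h`. -/
def IsFree (h : BrouwerHomeo) (E : Set Plane) : Prop :=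
  Disjoint (h.toHomeomorph '' E) E

/-- A closed topological disk: a subset of the plane homeomorphic to the closed unit disk. -/
def IsClosedDisk (D : Set Plane) : Prop :=
  Nonempty (D ≃ₜ (Metric.closedBall (0 : Plane) 1 : Set Plane))

/-- The topological limit superior of a sequence of subsets of the plane: the set of
points every neighborhood of which meets infinitely many terms of the sequence. -/
def limsupSet (A : ℕ → Set Plane) : Set Plane :=
  {x : Plane | ∀ V ∈ nhds x, {n : ℕ | (A n ∩ V).Nonempty}.Infinite}

open Complex in
/-- A continuous logarithm of `1` on a preconnected set is constant. -/
lemma eq_of_exp_eq_one {X : Type*} [TopologicalSpace X] {S : Set X} (hS : IsPreconnected S)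
    {f : X → ℂ} (hf : ContinuousOn f S) (h1 : ∀ x ∈ S, exp (f x) = 1) {x y : X}
    (hx : x ∈ S) (hy : y ∈ S) : f x = f y := by
  have hd : DiscreteTopology (AddSubgroup.zmultiples (2 * Real.pi * I) : Set ℂ) :=
    NormedSpace.discreteTopology_zmultiples _
  have hm : MapsTo f S (AddSubgroup.zmultiples (2 * Real.pi * I) : Set ℂ) := by
    intro z hz
    obtain ⟨n, hn⟩ := exp_eq_one_iff.1 (h1 z hz)
    exact AddSubgroup.mem_zmultiples_iff.2 ⟨n, by rw [hn, zsmul_eq_mul]⟩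
  obtain ⟨c, -, hc⟩ := hS.eqOn_const_of_mapsTo ⟨hd⟩ hf hm ⟨0, zero_mem _⟩
  exact (hc hx).trans (hc hy).symm

/-- A nonvanishing homotopy has a continuous logarithm extending a given initial one. -/
lemma exists_log_homotopy {A : Type*} [TopologicalSpace A] (F : unitInterval × A → ℂ)
    (hF : Continuous F) (hne : ∀ p, F p ≠ 0) (f : A → ℂ) (hf : Continuous f)
    (h0 : ∀ a, F (0, a) = Complex.exp (f a)) :
    ∃ G : unitInterval × A → ℂ, Continuous G ∧ (∀ p, Complex.exp (G p) = F p) ∧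
      ∀ a, G (0, a) = f a := by
  let F' : C(unitInterval × A, {z : ℂ // z ≠ 0}) := ⟨fun p => ⟨F p, hne p⟩, by fun_prop⟩
  have h0' : ∀ a, F' (0, a) = ⟨_, (f a).exp_ne_zero⟩ := fun a => Subtype.ext (h0 a)
  refine ⟨Complex.isCoveringMap_exp.liftHomotopy F' ⟨f, hf⟩ h0', ContinuousMap.continuous _,
    fun p => ?_, fun a => ?_⟩
  · exact congrArg Subtype.val
      (congrFun (Complex.isCoveringMap_exp.liftHomotopy_lifts F' ⟨f, hf⟩ h0') p)
  · exact Complex.isCoveringMap_exp.liftHomotopy_zero F' ⟨f, hf⟩ h0' a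

/-- A nonvanishing continuous function on a convex set has a continuous logarithm. -/
lemma Convex.exists_continuousOn_log {E : Type*} [NormedAddCommGroup E] [NormedSpace ℝ E]
    {S : Set E} (hS : Convex ℝ S) {f : E → ℂ} (hf : ContinuousOn f S)
    (hne : ∀ x ∈ S, f x ≠ 0) :
    ∃ g : E → ℂ, ContinuousOn g S ∧ ∀ x ∈ S, Complex.exp (g x) = f x := by
  rcases S.eq_empty_or_nonempty with rfl | ⟨x₀, hx₀⟩
  · exact ⟨0, by simp, by simp⟩
  have hmem : ∀ p : unitInterval × S, x₀ + (p.1 : ℝ) • ((p.2 : E) - x₀) ∈ S := fun p =>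
    hS.add_smul_sub_mem hx₀ p.2.2 p.1.2
  have hF : Continuous fun p : unitInterval × S => f (x₀ + (p.1 : ℝ) • ((p.2 : E) - x₀)) :=
    hf.comp_continuous (by fun_prop) hmem
  obtain ⟨G, hG, hGe, -⟩ := exists_log_homotopy _ hF (fun p => hne _ (hmem p))
    (fun _ => Complex.log (f x₀)) continuous_const
    (fun a => by simp [Complex.exp_log (hne _ hx₀)])
  classical
  refine ⟨fun x => if hx : x ∈ S then G (1, ⟨x, hx⟩) else 0, ?_, fun x hx => ?_⟩
  · rw [continuousOn_iff_continuous_domRestrict]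
    have : Continuous fun x : S => G (1, x) := by fun_prop
    convert this using 1
    ext x
    simp
  · simp [hx, hGe]

/-- A self-map of the complex plane has a *difference logarithm* if `(h y - h x) / (y - x)`,
for `x ≠ y`, has a continuous logarithm that is symmetric in `x` and `y`. -/
def HasDiffLog (h : ℂ → ℂ) : Prop :=
  ∃ W : ℂ × ℂ → ℂ, ContinuousOn W {p | p.1 ≠ p.2} ∧ (∀ x y, x ≠ y → W (x, y) = W (y, x)) ∧
    ∀ x y, x ≠ y → h y - h x = Complex.exp (W (x, y)) * (y - x)

lemma HasDiffLog.comp {f g : ℂ → ℂ} (hf : HasDiffLog f) (hg : HasDiffLog g)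
    (hgc : Continuous g) (hgi : Function.Injective g) : HasDiffLog (f ∘ g) := by
  obtain ⟨U, hU, hUs, hUe⟩ := hf
  obtain ⟨V, hV, hVs, hVe⟩ := hg
  refine ⟨fun p => U (g p.1, g p.2) + V p, ?_, fun x y hxy => ?_, fun x y hxy => ?_⟩
  · exact (hU.comp (by fun_prop) fun p hp => hgi.ne hp).add hV
  · simp only [hUs _ _ (hgi.ne hxy), hVs _ _ hxy]
  · simp only [Function.comp, hUe _ _ (hgi.ne hxy), hVe _ _ hxy, Complex.exp_add]
    ring

/-- A homeomorphism isotopic to the identity has a difference logarithm. -/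
lemma hasDiffLog_of_isotopy (H : unitInterval → ℂ → ℂ)
    (hc : Continuous fun p : unitInterval × ℂ => H p.1 p.2)
    (hi : ∀ t, Function.Injective (H t)) (h0 : ∀ x, H 0 x = x) : HasDiffLog (H 1) := by
  have hx : ∀ p : {p : ℂ × ℂ // p.1 ≠ p.2}, p.1.2 - p.1.1 ≠ 0 := fun p =>
    sub_ne_zero.2 p.2.symm
  have hswap : Continuous fun p : {p : ℂ × ℂ // p.1 ≠ p.2} =>
      (⟨p.1.swap, p.2.symm⟩ : {p : ℂ × ℂ // p.1 ≠ p.2}) :=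
    Continuous.subtype_mk (by fun_prop) _
  have hF : Continuous fun p : unitInterval × {p : ℂ × ℂ // p.1 ≠ p.2} =>
      (H p.1 p.2.1.2 - H p.1 p.2.1.1) / (p.2.1.2 - p.2.1.1) := by
    refine Continuous.div ?_ (by fun_prop) fun p => hx p.2
    exact (hc.comp (f := fun p : unitInterval × {p : ℂ × ℂ // p.1 ≠ p.2} => (p.1, p.2.1.2))
      (by fun_prop)).sub
      (hc.comp (f := fun p : unitInterval × {p : ℂ × ℂ // p.1 ≠ p.2} => (p.1, p.2.1.1))
      (by fun_prop))
  obtain ⟨G, hG, hGe, hG0⟩ := exists_log_homotopy _ hF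
    (fun p => div_ne_zero (sub_ne_zero.2 ((hi p.1).ne p.2.2.symm)) (hx p.2))
    (fun _ => 0) continuous_const (fun a => by simp [h0, div_self (hx a)])
  have hsymm : ∀ p : {p : ℂ × ℂ // p.1 ≠ p.2}, G (1, ⟨p.1.swap, p.2.symm⟩) = G (1, p) := by
    intro p
    have := eq_of_exp_eq_one (S := univ) (x := (1 : unitInterval)) (y := 0)
      (f := fun t => G (t, ⟨p.1.swap, p.2.symm⟩) - G (t, p)) isPreconnected_univ
      (Continuous.continuousOn (by fun_prop)) (fun t _ => ?_) trivial trivial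
    · simpa [hG0, sub_eq_zero] using this
    · have h1 := hx p
      have h2 : H t p.1.2 - H t p.1.1 ≠ 0 := sub_ne_zero.2 ((hi t).ne p.2.symm)
      have h3 : p.1.1 - p.1.2 ≠ 0 := sub_ne_zero.2 p.2
      rw [Complex.exp_sub, hGe, hGe, div_eq_one_iff_eq (div_ne_zero h2 h1)]
      simp only [Prod.fst_swap, Prod.snd_swap]
      rw [div_eq_div_iff h3 h1]
      ring
  classical
  refine ⟨fun p => if hp : p.1 ≠ p.2 then G (1, ⟨p, hp⟩) else 0, ?_, fun x y hxy => ?_,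
    fun x y hxy => ?_⟩
  · rw [continuousOn_iff_continuous_domRestrict]
    have : Continuous fun x : {p : ℂ × ℂ // p.1 ≠ p.2} => G (1, x) := by fun_prop
    refine this.congr fun x => ?_
    simp [x.2]
  · simpa [hxy, hxy.symm] using (hsymm ⟨(x, y), hxy⟩).symm
  · have := hGe (1, ⟨(x, y), hxy⟩)
    simp only [ne_eq, hxy, not_false_eq_true, dite_true, this]
    rw [div_mul_cancel₀ _ (sub_ne_zero.2 hxy.symm)]

open Complex in
/-- A line invariant under a fixed-point-free map with a difference logarithm cannot close up
for the first time at a gap larger than one. -/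
lemma line_apply_ne_of_first_gap {h : ℂ → ℂ} (hc : Continuous h) (hd : HasDiffLog h)
    (hfix : ∀ x, h x ≠ x) {L : ℝ → ℂ} (hL : Continuous L) (hLe : ∀ t, L (t + 1) = h (L t))
    {T : ℝ} (hT : 1 < T) (hinj : ∀ s t, s < t → t - s < T → L s ≠ L t) : L 0 ≠ L T := by
  intro h0T
  obtain ⟨W, hW, hWs, hWe⟩ := hd
  obtain ⟨θ, hθ, hθe⟩ := convex_univ.exists_continuousOn_log (f := fun x => h x - x)
    (by fun_prop) (fun x _ => sub_ne_zero.2 (hfix x))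
  rw [continuousOn_univ] at hθ
  set S : Set (ℝ × ℝ) := {p | p.1 < p.2 ∧ p.2 - p.1 < T} with hS
  have hSc : Convex ℝ S := by
    rintro ⟨a, b⟩ ⟨h1, h2⟩ ⟨c, d⟩ ⟨h3, h4⟩ u v hu hv huv
    simp only [hS, mem_ofPred_eq, Prod.smul_mk, Prod.mk_add_mk, smul_eq_mul] at *
    obtain rfl : u = 1 - v := by linarith
    constructor <;> rcases hv.eq_or_lt with rfl | hv'
    · linarith
    · nlinarith
    · linarith
    · nlinarith
  have hne : ∀ p ∈ S, L p.1 ≠ L p.2 := fun p hp => hinj _ _ hp.1 hp.2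
  obtain ⟨Φ, hΦ, hΦe⟩ := hSc.exists_continuousOn_log (f := fun p => L p.2 - L p.1)
    (by fun_prop) (fun p hp => sub_ne_zero.2 (hne p hp).symm)
  have hΦe' : ∀ s t, s < t → t - s < T → exp (Φ (s, t)) = L t - L s :=
    fun s t h1 h2 => hΦe (s, t) ⟨h1, h2⟩
  have hA : Φ (T, T + 1) = Φ (0, 1) := by
    have := eq_of_exp_eq_one (S := univ) (f := fun t : ℝ => Φ (t, t + 1) - θ (L t))
      isPreconnected_univ
      (((hΦ.comp_continuous (f := fun t : ℝ => (t, t + 1)) (by fun_prop)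
        (fun t => ⟨by simp, by simpa using hT⟩)).sub (hθ.comp hL)).continuousOn)
      (fun t _ => by
        rw [exp_sub, hΦe' _ _ (by linarith) (by linarith), hθe _ trivial, hLe,
          div_self (sub_ne_zero.2 (hfix _))]) (x := T) (y := 0) trivial trivial
    simpa [← h0T] using this
  have hB : Φ (T - 1 + 1, T + 1) - Φ (T - 1, T) - W (L (T - 1), L T) =
      Φ (0 + 1, T - 1 + 1) - Φ (0, T - 1) - W (L 0, L (T - 1)) := by
    refine eq_of_exp_eq_one (S := S) (x := (T - 1, T)) (y := (0, T - 1))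
      (f := fun p => Φ (p.1 + 1, p.2 + 1) - Φ p - W (L p.1, L p.2)) hSc.isPreconnected
      (((hΦ.comp (by fun_prop) fun p hp => ?_).sub hΦ).sub (hW.comp (by fun_prop) hne))
      (fun p hp => ?_) ⟨by simp, by simpa using hT⟩ ⟨by simpa using hT, by simp⟩
    · exact ⟨by simpa using hp.1, by simpa using hp.2⟩
    · have h1 : L p.2 - L p.1 ≠ 0 := sub_ne_zero.2 (hne p hp).symm
      rw [exp_sub, exp_sub, hΦe' _ _ (by simpa using hp.1) (by simpa using hp.2), hΦe _ hp, hLe,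
        hLe, hWe _ _ (hne p hp), mul_div_cancel_right₀ _ h1, div_self (exp_ne_zero _)]
  have hD := eq_of_exp_eq_one (S := Ioo 0 T) (x := 1) (y := T / 2)
    (f := fun u => Φ (T - u, T) - Φ (0, u) + (Φ (u, T) - Φ (0, T - u))) isPreconnected_Ioo
    (((hΦ.comp (by fun_prop) ?_).sub (hΦ.comp (by fun_prop) ?_)).add
      ((hΦ.comp (by fun_prop) ?_).sub (hΦ.comp (by fun_prop) ?_))) (fun u hu => ?_)
    ⟨one_pos, hT⟩ ⟨by linarith, by linarith⟩
  · have hW' : W (L (T - 1), L T) = W (L 0, L (T - 1)) := by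
      rw [← h0T]
      exact hWs _ _ (hinj 0 (T - 1) (by linarith) (by linarith)).symm
    rw [hW'] at hB
    simp only [sub_add_cancel, zero_add] at hB
    have h2 : Φ (T / 2, T) = Φ (0, T / 2) := by
      have : T - T / 2 = T / 2 := by ring
      simp only [this] at hD
      linear_combination (-1 / 2 : ℂ) * hD + (1 / 2 : ℂ) * hA - (1 / 2 : ℂ) * hB
    have h3 := congrArg exp h2
    rw [hΦe' _ _ (by linarith) (by linarith), hΦe' _ _ (by linarith) (by linarith), ← h0T] at h3
    exact hinj 0 (T / 2) (by linarith) (by linarith) (by linear_combination h3 / 2)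
  · exact fun u hu => ⟨by simpa using hu.1, by simpa using hu.2⟩
  · exact fun u hu => ⟨by simpa using hu.1, by simpa using hu.2⟩
  · exact fun u hu => ⟨by simpa using hu.2, by simpa using hu.1⟩
  · exact fun u hu => ⟨by simpa using hu.2, by simpa using hu.1⟩
  · obtain ⟨hu0, huT⟩ := hu
    have h1 : L u - L 0 ≠ 0 := sub_ne_zero.2 (hinj 0 u hu0 (by linarith)).symm
    have h2 : L (T - u) - L 0 ≠ 0 :=
      sub_ne_zero.2 (hinj 0 (T - u) (by linarith) (by linarith)).symm
    rw [exp_add, exp_sub, exp_sub, hΦe' _ _ (by linarith) (by linarith),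
      hΦe' _ _ (by linarith) (by linarith), hΦe' _ _ (by linarith) (by linarith),
      hΦe' _ _ (by linarith) (by linarith), ← h0T]
    field_simp
    ring

/-- Brouwer's lemma on translation arcs: an invariant line of a fixed-point-free map with a
difference logarithm is injective as soon as it has no coincidences of gap less than one. -/
lemma line_injective {h : ℂ → ℂ} (hc : Continuous h) (hi : Function.Injective h)
    (hd : HasDiffLog h)
    (hfix : ∀ x, h x ≠ x) {L : ℝ → ℂ} (hL : Continuous L) (hLe : ∀ t, L (t + 1) = h (L t))
    (hinj : ∀ s t, s < t → t - s < 1 → L s ≠ L t) : Function.Injective L := by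
  have hshift : ∀ (n : ℕ) (s t : ℝ), L (s + n) = L (t + n) ↔ L s = L t := by
    intro n s t
    induction n with
    | zero => simp
    | succ k ih => simp only [Nat.cast_add, Nat.cast_one, ← add_assoc, hLe, hi.eq_iff, ih]
  have hfract : ∀ s t, L s = L t → L (Int.fract s) = L (Int.fract s + (t - s)) := by
    intro s t hst
    obtain ⟨n, hn | hn⟩ := Int.eq_nat_or_neg ⌊s⌋
    · rw [← hshift n]
      have : Int.fract s + n = s := by
        have := Int.fract_add_floor s
        rw [hn] at this
        exact_mod_cast this
      rw [add_right_comm, this, hst]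
      congr 1
      ring
    · have : s + n = Int.fract s := by
        have := Int.fract_add_floor s
        rw [hn] at this
        push_cast at this
        linarith
      rw [← this, add_right_comm, hshift, hst]
      congr 1
      ring
  suffices H : ∀ s t, s < t → L s ≠ L t by
    intro s t hst
    by_contra hne
    rcases lt_or_gt_of_ne hne with h1 | h1
    · exact H _ _ h1 hst
    · exact H _ _ h1 hst.symm
  intro s t hst hLst
  have h1 : ∀ s t, s < t → L s = L t → 1 < t - s := by
    intro s t h2 h3
    by_contra! h4
    rcases h4.lt_or_eq with h5 | h5
    · exact hinj s t h2 h5 h3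
    · obtain rfl : t = s + 1 := by linarith
      exact hfix _ ((hLe s).symm.trans h3.symm)
  let K : Set (ℝ × ℝ) := (Icc 0 1 ×ˢ Icc 1 (t - s)) ∩ {p | L p.1 = L (p.1 + p.2)}
  have hK : IsCompact K := (isCompact_Icc.prod isCompact_Icc).inter_right
    (isClosed_eq (by fun_prop) (by fun_prop))
  have hKne : K.Nonempty := ⟨(Int.fract s, t - s),
    ⟨⟨Int.fract_nonneg s, (Int.fract_lt_one s).le⟩, ⟨(h1 s t hst hLst).le, le_rfl⟩⟩,
    hfract s t hLst⟩
  obtain ⟨⟨a, T⟩, ⟨⟨-, ⟨hT1, hTs⟩⟩, haT⟩, hmin⟩ :=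
    hK.exists_isMinOn hKne (f := Prod.snd) continuous_snd.continuousOn
  simp only [mem_ofPred_eq] at haT hT1 hTs
  have hT : 1 < T := by
    have := h1 a (a + T) (by linarith) haT
    linarith
  refine line_apply_ne_of_first_gap hc hd hfix (L := fun x => L (a + x)) (by fun_prop)
    (fun t => by rw [← add_assoc, hLe]) hT (fun u v huv huvT huv' => ?_) (by simpa using haT)
  have h2 := h1 _ _ (by linarith) huv'
  have h3 := hmin (a := (Int.fract (a + u), v - u)) ⟨⟨⟨Int.fract_nonneg _,
    (Int.fract_lt_one _).le⟩, ⟨by linarith, by linarith⟩⟩, by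
      have := hfract _ _ huv'
      simp only [mem_ofPred_eq, this]
      congr 1
      ring⟩
  simp only [mem_ofPred_eq] at h3
  linarith

/-- An arc from `α 0` to `h (α 0)` extends to an `h`-equivariant line. -/
lemma exists_equivariant_line (h : ℂ ≃ₜ ℂ) {α : ℝ → ℂ} (hα : Continuous α)
    (h01 : α 1 = h (α 0)) :
    ∃ L : ℝ → ℂ, Continuous L ∧ (∀ t, L (t + 1) = h (L t)) ∧ ∀ t ∈ Icc (0 : ℝ) 1, L t = α t := by
  have hs : ∀ (n : ℤ) (x : ℂ), (h ^ (n + 1)) x = h ((h ^ n) x) := fun n x => by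
    rw [add_comm, zpow_one_add]; rfl
  have hs' : ∀ (n : ℤ) (x : ℂ), (h ^ (n + 1)) x = (h ^ n) (h x) := fun n x => by
    rw [zpow_add_one]; rfl
  refine ⟨fun t => (h ^ ⌊t⌋) (α (Int.fract t)), ?_, fun t => ?_, fun t ht => ?_⟩
  · rw [continuous_iff_continuousAt]
    intro t₀
    set n := ⌊t₀⌋ with hn
    have hc : Continuous fun t : ℝ =>
        if t ≤ n then (h ^ (n - 1)) (α (t - n + 1)) else (h ^ n) (α (t - n)) := by
      refine Continuous.if_le ((h ^ (n - 1)).continuous.comp (by fun_prop))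
        ((h ^ n).continuous.comp (by fun_prop)) (by fun_prop) (by fun_prop) fun t ht => ?_
      have := hs' (n - 1) (α 0)
      rw [sub_add_cancel] at this
      rw [ht, sub_self, zero_add, h01, this]
    refine hc.continuousAt.congr ?_
    have hmem : t₀ ∈ Ioo ((n : ℝ) - 1) (n + 1) :=
      ⟨by have := Int.floor_le t₀; rw [← hn] at this; linarith, Int.lt_floor_add_one t₀⟩
    filter_upwards [isOpen_Ioo.mem_nhds hmem] with t ht
    rcases lt_trichotomy t n with h1 | h1 | h1
    · have hf : ⌊t⌋ = n - 1 := Int.floor_eq_iff.2 ⟨by push_cast; exact ht.1.le, by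
        push_cast; linarith⟩
      rw [if_pos h1.le, Int.fract, hf]
      push_cast
      congr 2
      ring
    · subst h1
      have := hs' (n - 1) (α 0)
      rw [sub_add_cancel] at this
      simp [h01, this]
    · have hf : ⌊t⌋ = n := Int.floor_eq_iff.2 ⟨h1.le, ht.2⟩
      rw [if_neg (not_le.2 h1), Int.fract, hf]
  · simp [hs]
  · rcases ht.2.eq_or_lt with rfl | h1
    · simp [h01]
    · have hf : ⌊t⌋ = 0 := Int.floor_eq_iff.2 ⟨by simpa using ht.1, by simpa using h1⟩
      simp only [Int.fract, hf]
      simp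

/-- If `x` minimizes the larger of the distances from `p` to `y` and to `h y`, then `h x` is at
most as far from `p` as `x`. -/
lemma norm_map_sub_le_of_forall_le (h : ℂ ≃ₜ ℂ) {p x : ℂ}
    (hmin : ∀ y, max ‖x - p‖ ‖h x - p‖ ≤ max ‖y - p‖ ‖h y - p‖) : ‖h x - p‖ ≤ ‖x - p‖ := by
  by_contra! hlt
  have hpos : 0 < ‖h x - p‖ := (norm_nonneg _).trans_lt hlt
  rw [max_eq_right hlt.le] at hmin
  have hcont : Continuous fun s : ℝ => ‖h.symm (h x + (s : ℂ) * (p - h x)) - p‖ :=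
    ((h.symm.continuous.comp (by fun_prop)).sub continuous_const).norm
  have hev : ∀ᶠ s : ℝ in 𝓝 0, ‖h.symm (h x + (s : ℂ) * (p - h x)) - p‖ < ‖h x - p‖ :=
    hcont.continuousAt.eventually_lt continuousAt_const (by simpa using hlt)
  obtain ⟨s, hs, hs0, hs1⟩ := (((hev.filter_mono nhdsWithin_le_nhds).and
    (Ioo_mem_nhdsGT (zero_lt_one' ℝ))).exists : ∃ s : ℝ, _)
  have h2 := hmin (h.symm (h x + (s : ℂ) * (p - h x)))
  rw [h.apply_symm_apply] at h2
  have h3 : ‖h x + (s : ℂ) * (p - h x) - p‖ < ‖h x - p‖ := by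
    have : h x + (s : ℂ) * (p - h x) - p = ((1 - s : ℝ) : ℂ) * (h x - p) := by
      push_cast; ring
    rw [this, norm_mul, Complex.norm_real, Real.norm_of_nonneg (by linarith)]
    nlinarith
  exact absurd h2 (not_le.2 (max_lt hs h3))

/-- A fixed-point-free homeomorphism of the plane with a difference logarithm has no periodic
point. -/
theorem iterate_ne_self (h : ℂ ≃ₜ ℂ) (hd : HasDiffLog h) (hfix : ∀ x, h x ≠ x) {n : ℕ}
    (hn : 0 < n) (p : ℂ) : h^[n] p ≠ p := by
  intro hp
  obtain ⟨x, hmin⟩ : ∃ x, ∀ y, max ‖x - p‖ ‖h x - p‖ ≤ max ‖y - p‖ ‖h y - p‖ := by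
    refine Continuous.exists_forall_le (f := fun y => max ‖y - p‖ ‖h y - p‖)
      (by have := h.continuous; fun_prop) ?_
    refine tendsto_atTop_mono (fun y => le_max_left _ _) ?_
    have := tendsto_norm_cocompact_atTop.comp
      (Homeomorph.subRight p).isClosedEmbedding.tendsto_cocompact
    exact this
  have h1 := norm_map_sub_le_of_forall_le h hmin
  have h2 : ‖x - p‖ ≤ ‖h x - p‖ := by
    have := norm_map_sub_le_of_forall_le h.symm (p := p) (x := h x) fun y => by
      have := hmin (h.symm y)
      rw [h.apply_symm_apply] at this
      rwa [h.symm_apply_apply, max_comm, max_comm ‖y - p‖]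
    rwa [h.symm_apply_apply] at this
  have heq : ‖h x - p‖ = ‖x - p‖ := le_antisymm h1 h2
  rw [heq, max_self] at hmin
  set r := ‖x - p‖ with hr
  have hr0 : 0 < r := by
    rcases (norm_nonneg (x - p)).eq_or_lt with h0 | h0
    · exfalso
      have hxp : x = p := sub_eq_zero.1 (norm_eq_zero.1 h0.symm)
      rw [hr, ← h0] at heq
      have hhp := sub_eq_zero.1 (norm_eq_zero.1 heq)
      exact hfix x (hhp.trans hxp.symm)
    · exact h0
  let α : ℝ → ℂ := fun t => p + ((max (1 - 2 * t) 0 : ℝ) : ℂ) * (x - p) +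
    ((max (2 * t - 1) 0 : ℝ) : ℂ) * (h x - p)
  have hα : Continuous α := by fun_prop
  have hα1 : ∀ t ≤ 1 / 2, α t = p + ((1 - 2 * t : ℝ) : ℂ) * (x - p) := fun t ht => by
    simp only [α]
    rw [max_eq_left (by linarith), max_eq_right (by linarith)]
    simp
  have hα2 : ∀ t ≥ 1 / 2, α t = p + ((2 * t - 1 : ℝ) : ℂ) * (h x - p) := fun t ht => by
    simp only [α]
    rw [max_eq_right (by linarith), max_eq_left (by linarith)]
    simp
  have hαn : ∀ t, ‖α t - p‖ = |1 - 2 * t| * r := fun t => by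
    rcases le_total t (1 / 2) with ht | ht
    · rw [hα1 t ht, add_sub_cancel_left, norm_mul, Complex.norm_real, Real.norm_eq_abs]
    · rw [hα2 t ht, add_sub_cancel_left, norm_mul, Complex.norm_real, Real.norm_eq_abs, heq,
        abs_sub_comm]
  have hα0 : α 0 = x := by rw [hα1 0 (by norm_num)]; simp
  have hα01 : α 1 = h (α 0) := by rw [hα0, hα2 1 (by norm_num)]; norm_num
  have hinj : ∀ s t, s < t → α s ≠ α t := by
    intro s t hst he
    have h3 : |1 - 2 * s| = |1 - 2 * t| :=
      mul_right_cancel₀ hr0.ne' (by rw [← hαn, ← hαn, he])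
    rcases abs_eq_abs.1 h3 with h4 | h4
    · linarith
    · rw [hα1 s (by linarith), hα2 t (by linarith), show 2 * t - 1 = 1 - 2 * s by linarith] at he
      have h5 : ((1 - 2 * s : ℝ) : ℂ) ≠ 0 := Complex.ofReal_ne_zero.2 (by linarith)
      have h6 := mul_left_cancel₀ h5 (add_left_cancel he)
      exact hfix x (sub_left_injective h6).symm
  obtain ⟨L, hL, hLe, hLα⟩ := exists_equivariant_line h hα hα01
  have hLn : ∀ (k : ℕ) (t : ℝ), L (t + k) = h^[k] (L t) := by
    intro k t
    induction k with
    | zero => simp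
    | succ k ih =>
      rw [Function.iterate_succ_apply', ← ih, ← hLe, Nat.cast_succ, add_assoc]
  have hlocal : ∀ s t, 0 ≤ s → s < 1 → s < t → t - s < 1 → L s ≠ L t := by
    intro s t hs0 hs1 hst hts he
    rw [hLα s ⟨hs0, hs1.le⟩] at he
    rcases le_or_gt t 1 with ht | ht
    · rw [hLα t ⟨by linarith, ht⟩] at he
      exact hinj s t hst he
    · have h3 : L t = h (α (t - 1)) := by
        rw [← hLα (t - 1) ⟨by linarith, by linarith⟩, ← hLe, sub_add_cancel]
      rw [h3] at he
      have h4 := hmin (α (t - 1))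
      rw [← he, hαn, hαn] at h4
      refine absurd h4 (not_le.2 (max_lt ?_ ?_))
      · have : |1 - 2 * (t - 1)| < 1 := abs_lt.2 ⟨by linarith, by linarith⟩
        nlinarith
      · have : |1 - 2 * s| < 1 := abs_lt.2 ⟨by linarith, by linarith⟩
        nlinarith
  have hLz : ∀ (k : ℤ) (t : ℝ), L (t + k) = (h ^ k) (L t) := by
    intro k t
    induction k with
    | zero => simp
    | succ k ih =>
      rw [add_comm (k : ℤ), zpow_one_add, add_comm (1 : ℤ)]
      push_cast
      rw [← add_assoc, hLe]
      exact congrArg h (by simpa using ih)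
    | pred k ih =>
      apply h.injective
      rw [← hLe]
      have h3 : (h ^ (-(k : ℤ))) (L t) = h ((h ^ (-(k : ℤ) - 1)) (L t)) := by
        conv_lhs => rw [← sub_add_cancel (-(k : ℤ)) 1, add_comm, zpow_one_add]
        rfl
      rw [← h3, ← ih]
      congr 1
      push_cast
      ring
  have hLinj := line_injective h.continuous h.injective hd hfix hL hLe fun s t hst hts he => by
    have h3 := congrArg (h ^ (-⌊s⌋)) he
    rw [← hLz, ← hLz] at h3
    push_cast at h3
    refine hlocal _ _ ?_ ?_ ?_ ?_ h3
    · linarith [Int.floor_le s]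
    · linarith [Int.lt_floor_add_one s]
    · linarith
    · linarith
  have h5 : L (1 / 2) = p := by
    rw [hLα _ ⟨by norm_num, by norm_num⟩, hα1 _ le_rfl]
    simp
  have h6 : L (1 / 2 + n) = L (1 / 2) := by rw [hLn, h5, hp]
  have h7 := hLinj h6
  have h8 : (0 : ℝ) < n := by exact_mod_cast hn
  linarith

lemma hasDiffLog_of_mem_slitPlane {φ : ℂ → ℂ} (hc : Continuous φ)
    (h : ∀ x y, x ≠ y → (φ y - φ x) / (y - x) ∈ Complex.slitPlane) : HasDiffLog φ := by
  refine ⟨fun p => Complex.log ((φ p.2 - φ p.1) / (p.2 - p.1)), ?_, fun x y hxy => ?_,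
    fun x y hxy => ?_⟩
  · refine ContinuousOn.clog (ContinuousOn.div (by fun_prop) (by fun_prop) fun p hp =>
      sub_ne_zero.2 (Ne.symm hp)) fun p hp => h _ _ hp
  · simp only
    rw [← neg_sub (φ x), ← neg_sub x, neg_div_neg_eq]
  · simp only
    rw [Complex.exp_log (Complex.slitPlane_ne_zero (h x y hxy)),
      div_mul_cancel₀ _ (sub_ne_zero.2 hxy.symm)]

/-- A piecewise linear increasing map of the line, sending `0` to `b` and fixing everything
outside `(-η, 1 + η)`. -/
noncomputable def slide (η b s : ℝ) : ℝ :=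
  max s (min (b + (1 + b / η) * s) (b + (1 - b / (1 + η)) * s))

/-- The inverse of `slide`. -/
noncomputable def slideInv (η b u : ℝ) : ℝ :=
  min u (max ((u - b) / (1 + b / η)) ((u - b) / (1 - b / (1 + η))))

section slide

variable {η b : ℝ}

lemma slide_coeff_pos (hη : 0 < η) (hb0 : 0 ≤ b) (hb1 : b ≤ 1) :
    0 < 1 + b / η ∧ 0 < 1 - b / (1 + η) := by
  refine ⟨by positivity, ?_⟩
  rw [sub_pos, div_lt_one (by linarith)]
  linarith

lemma slide_le_iff (hη : 0 < η) (hb0 : 0 ≤ b) (hb1 : b ≤ 1) (s u : ℝ) :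
    slide η b s ≤ u ↔ s ≤ slideInv η b u := by
  obtain ⟨h1, h2⟩ := slide_coeff_pos hη hb0 hb1
  simp only [slide, slideInv, max_le_iff, min_le_iff, le_min_iff, le_max_iff, le_div_iff₀ h1,
    le_div_iff₀ h2, le_sub_iff_add_le', mul_comm s]

lemma le_slide_iff (hη : 0 < η) (hb0 : 0 ≤ b) (hb1 : b ≤ 1) (s u : ℝ) :
    u ≤ slide η b s ↔ slideInv η b u ≤ s := by
  obtain ⟨h1, h2⟩ := slide_coeff_pos hη hb0 hb1
  simp only [slide, slideInv, max_le_iff, min_le_iff, le_min_iff, le_max_iff, div_le_iff₀ h1,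
    div_le_iff₀ h2, sub_le_iff_le_add', mul_comm s]

lemma slideInv_slide (hη : 0 < η) (hb0 : 0 ≤ b) (hb1 : b ≤ 1) (s : ℝ) :
    slideInv η b (slide η b s) = s :=
  le_antisymm ((le_slide_iff hη hb0 hb1 _ _).1 le_rfl) ((slide_le_iff hη hb0 hb1 _ _).1 le_rfl)

lemma slide_slideInv (hη : 0 < η) (hb0 : 0 ≤ b) (hb1 : b ≤ 1) (u : ℝ) :
    slide η b (slideInv η b u) = u :=
  le_antisymm ((slide_le_iff hη hb0 hb1 _ _).2 le_rfl) ((le_slide_iff hη hb0 hb1 _ _).2 le_rfl)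

lemma slide_strictMono (hη : 0 < η) (hb0 : 0 ≤ b) (hb1 : b ≤ 1) : StrictMono (slide η b) := by
  intro s t hst
  rwa [← not_le, slide_le_iff hη hb0 hb1, slideInv_slide hη hb0 hb1, not_le]

lemma mem_Ioo_of_slide_ne (hη : 0 < η) (hb0 : 0 ≤ b) {s : ℝ} (h : slide η b s ≠ s) :
    0 < b ∧ s ∈ Ioo (-η) (1 + η) := by
  have h1 : s < min (b + (1 + b / η) * s) (b + (1 - b / (1 + η)) * s) := by
    by_contra! h2
    exact h (max_eq_left h2)
  have h2 : 0 < b * (1 + s / η) := by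
    have := lt_of_lt_of_le h1 (min_le_left _ _)
    have e : b * (1 + s / η) = b + (1 + b / η) * s - s := by ring
    linarith
  have h3 : 0 < b * (1 - s / (1 + η)) := by
    have := lt_of_lt_of_le h1 (min_le_right _ _)
    have e : b * (1 - s / (1 + η)) = b + (1 - b / (1 + η)) * s - s := by ring
    linarith
  have hb : 0 < b := hb0.lt_of_ne (by rintro rfl; simp at h2)
  have h4 := pos_of_mul_pos_right h2 hb0
  have h5 := pos_of_mul_pos_right h3 hb0
  refine ⟨hb, ?_, ?_⟩
  · have : -1 < s / η := by linarith
    rw [lt_div_iff₀ hη] at this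
    linarith
  · have : s / (1 + η) < 1 := by linarith
    rwa [div_lt_one (by linarith)] at this

end slide

/-- A homeomorphism of the plane supported near the unit segment and sending `0` to `1`. -/
lemma exists_push_zero_one {η : ℝ} (hη : 0 < η) :
    ∃ ψ : ℂ ≃ₜ ℂ, (∀ x y, x ≠ y → (ψ y - ψ x) / (y - x) ∈ Complex.slitPlane) ∧ ψ 0 = 1 ∧
      ∀ w, ψ w ≠ w → w.re ∈ Ioo (-η) (1 + η) ∧ |w.im| < η := by
  let β : ℝ → ℝ := fun y => max 0 (1 - |y| / η)
  have hβc : Continuous β := by fun_prop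
  have hβ0 : ∀ y, 0 ≤ β y := fun y => le_max_left _ _
  have hβ1 : ∀ y, β y ≤ 1 := fun y => max_le zero_le_one (by
    have : 0 ≤ |y| / η := by positivity
    linarith)
  have hco := fun y => slide_coeff_pos hη (hβ0 y) (hβ1 y)
  let ψ : ℂ ≃ₜ ℂ :=
    { toFun := fun w => (slide η (β w.im) w.re : ℂ) + w.im * Complex.I
      invFun := fun w => (slideInv η (β w.im) w.re : ℂ) + w.im * Complex.I
      left_inv := fun w => by
        apply Complex.ext <;> simp [slideInv_slide hη (hβ0 _) (hβ1 _)]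
      right_inv := fun w => by
        apply Complex.ext <;> simp [slide_slideInv hη (hβ0 _) (hβ1 _)]
      continuous_toFun := by unfold slide; fun_prop
      continuous_invFun := by
        unfold slideInv
        have h1 : Continuous fun w : ℂ => (w.re - β w.im) / (1 + β w.im / η) :=
          Continuous.div (by fun_prop) (by fun_prop) fun w => (hco _).1.ne'
        have h2 : Continuous fun w : ℂ => (w.re - β w.im) / (1 - β w.im / (1 + η)) :=
          Continuous.div (by fun_prop) (by fun_prop) fun w => (hco _).2.ne'
        fun_prop }
  have hψ : ∀ w, ψ w = (slide η (β w.im) w.re : ℂ) + w.im * Complex.I := fun w => rfl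
  refine ⟨ψ, fun x y hxy => ?_, ?_, fun w hw => ?_⟩
  · have h0 : y - x ≠ 0 := sub_ne_zero.2 hxy.symm
    rw [Complex.mem_slitPlane_iff_not_le_zero]
    intro hle
    obtain ⟨hre, him⟩ := Complex.le_def.1 hle
    set q := (ψ y - ψ x) / (y - x) with hq
    have hqr : q = (q.re : ℂ) := Complex.ext (by simp) (by simpa using him)
    have hmul : ψ y - ψ x = (q.re : ℂ) * (y - x) := by
      rw [← hqr, hq, div_mul_cancel₀ _ h0]
    have hI : y.im - x.im = q.re * (y.im - x.im) := by
      simpa [hψ] using congrArg Complex.im hmul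
    have hR : slide η (β y.im) y.re - slide η (β x.im) x.re = q.re * (y.re - x.re) := by
      simpa [hψ] using congrArg Complex.re hmul
    simp only [Complex.zero_re] at hre
    have him : y.im = x.im := by nlinarith [sq_nonneg (y.im - x.im)]
    rw [him] at hR
    have hm := slide_strictMono hη (hβ0 x.im) (hβ1 x.im)
    rcases lt_trichotomy x.re y.re with h1 | h1 | h1
    · nlinarith [hm h1]
    · exact hxy (Complex.ext h1 him.symm)
    · nlinarith [hm h1]
  · rw [hψ]
    simp [slide, β]
  · have h1 : slide η (β w.im) w.re ≠ w.re := fun h => hw (by rw [hψ, h, Complex.re_add_im])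
    obtain ⟨h2, h3⟩ := mem_Ioo_of_slide_ne hη (hβ0 _) h1
    refine ⟨h3, ?_⟩
    have h4 : 0 < 1 - |w.im| / η := by
      rcases lt_max_iff.1 h2 with h | h
      · exact absurd h (lt_irrefl _)
      · exact h
    rwa [sub_pos, div_lt_one hη] at h4

/-- A point can be pushed along a segment by a homeomorphism supported near the segment. -/
lemma exists_push {a b : ℂ} {U : Set ℂ} (hU : IsOpen U) (hab : segment ℝ a b ⊆ U) :
    ∃ φ : ℂ ≃ₜ ℂ, HasDiffLog φ ∧ φ a = b ∧ ∀ x ∉ U, φ x = x := by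
  rcases eq_or_ne a b with rfl | hne
  · refine ⟨Homeomorph.refl ℂ, hasDiffLog_of_mem_slitPlane continuous_id fun x y hxy => ?_, rfl,
      fun _ _ => rfl⟩
    simp [div_self (sub_ne_zero.2 hxy.symm)]
  have hv : b - a ≠ 0 := sub_ne_zero.2 hne.symm
  let e : ℂ ≃ₜ ℂ := (Homeomorph.mulLeft₀ (b - a) hv).trans (Homeomorph.addLeft a)
  have he : ∀ w, e w = a + (b - a) * w := fun w => rfl
  have hK : IsCompact ((fun c : ℝ => (c : ℂ)) '' Icc 0 1) :=
    isCompact_Icc.image Complex.continuous_ofReal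
  obtain ⟨ε, hε, hεU⟩ := hK.exists_thickening_subset_open (hU.preimage e.continuous) (by
    rintro _ ⟨c, hc, rfl⟩
    refine hab ?_
    rw [segment_eq_image']
    exact ⟨c, hc, by simp [he, mul_comm]⟩)
  obtain ⟨ψ, hψs, hψ0, hψ⟩ := exists_push_zero_one (half_pos hε)
  refine ⟨e.symm.trans (ψ.trans e), hasDiffLog_of_mem_slitPlane (Homeomorph.continuous _)
    fun x y hxy => ?_, ?_, fun x hx => ?_⟩
  · obtain ⟨x, rfl⟩ := e.surjective x
    obtain ⟨y, rfl⟩ := e.surjective y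
    have h1 := hψs x y (fun h => hxy (congrArg e h))
    simp only [Homeomorph.trans_apply, Homeomorph.symm_apply_apply]
    rw [he, he, he, he, add_sub_add_left_eq_sub, add_sub_add_left_eq_sub, ← mul_sub, ← mul_sub,
      mul_div_mul_left _ _ hv]
    exact h1
  · have : e.symm a = 0 := by rw [e.symm_apply_eq, he]; simp
    simp [this, hψ0, he]
  · obtain ⟨w, rfl⟩ := e.surjective x
    simp only [Homeomorph.trans_apply, Homeomorph.symm_apply_apply]
    by_contra hw
    obtain ⟨⟨h1, h2⟩, h3⟩ := hψ w (fun h => hw (congrArg e h))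
    refine hx (hεU (Metric.mem_thickening_iff.2 ⟨_, ⟨max 0 (min w.re 1), ⟨le_max_left _ _,
      max_le zero_le_one (min_le_right _ _)⟩, rfl⟩, ?_⟩))
    rw [dist_eq_norm]
    refine (Complex.norm_le_abs_re_add_abs_im _).trans_lt ?_
    have h4 : |w.re - max 0 (min w.re 1)| ≤ ε / 2 := by
      rw [abs_le]
      constructor <;> rcases max_cases 0 (min w.re 1) with ⟨h, h'⟩ | ⟨h, h'⟩ <;>
        rcases min_cases w.re 1 with ⟨h5, h6⟩ | ⟨h5, h6⟩ <;> rw [h] <;> linarith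
    simp only [Complex.sub_re, Complex.sub_im, Complex.ofReal_re, Complex.ofReal_im, sub_zero]
    linarith

/-- Finitely many pushes with pairwise disjoint supports can be performed simultaneously. -/
lemma exists_push_finset {ι : Type*} (s : Finset ι) {a b : ι → ℂ} {U : ι → Set ℂ}
    (hU : ∀ i, IsOpen (U i)) (hab : ∀ i, segment ℝ (a i) (b i) ⊆ U i)
    (hdisj : Pairwise (Function.onFun Disjoint U)) :
    ∃ φ : ℂ ≃ₜ ℂ, HasDiffLog φ ∧ (∀ i ∈ s, φ (a i) = b i) ∧
      (∀ i ∈ s, MapsTo φ (U i) (U i)) ∧ ∀ x, (∀ i ∈ s, x ∉ U i) → φ x = x := by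
  classical
  induction s using Finset.induction_on with
  | empty =>
    refine ⟨Homeomorph.refl ℂ, hasDiffLog_of_mem_slitPlane continuous_id fun x y hxy => ?_,
      by simp, by simp, fun _ _ => rfl⟩
    simp [div_self (sub_ne_zero.2 hxy.symm)]
  | insert k s hk ih =>
    obtain ⟨φ, hφ, hφa, hφU, hφx⟩ := ih
    obtain ⟨χ, hχ, hχa, hχx⟩ := exists_push (hU k) (hab k)
    have hχU : MapsTo χ (U k) (U k) := by
      intro x hx
      by_contra h
      exact h ((χ.injective (hχx _ h)).symm ▸ hx)
    have hne : ∀ i ∈ s, i ≠ k := fun i hi => ne_of_mem_of_not_mem hi hk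
    have hφk : ∀ x ∈ U k, φ x = x := fun x hx =>
      hφx x fun i hi hxi => disjoint_left.1 (hdisj (hne i hi)) hxi hx
    have hχs : ∀ i ∈ s, ∀ x ∈ U i, χ x = x := fun i hi x hx =>
      hχx x fun hxk => disjoint_left.1 (hdisj (hne i hi)) hx hxk
    refine ⟨φ.trans χ, hχ.comp hφ φ.continuous φ.injective, ?_, ?_, fun x hx => ?_⟩
    · rw [Finset.forall_mem_insert]
      refine ⟨?_, fun i hi => ?_⟩
      · rw [Homeomorph.trans_apply, hφk _ (hab k (left_mem_segment ℝ _ _)), hχa]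
      · rw [Homeomorph.trans_apply, hφa i hi, hχs i hi _ (hab i (right_mem_segment ℝ _ _))]
    · rw [Finset.forall_mem_insert]
      refine ⟨fun x hx => ?_, fun i hi x hx => ?_⟩
      · rw [Homeomorph.trans_apply, hφk x hx]
        exact hχU hx
      · rw [Homeomorph.trans_apply, hχs i hi _ (hφU i hi hx)]
        exact hφU i hi hx
    · rw [Finset.forall_mem_insert] at hx
      rw [Homeomorph.trans_apply, hφx x hx.2, hχx x hx.1]

/-- Finitely many pairwise disjoint nonempty compact sets have pairwise disjoint open
neighborhoods. -/
lemma exists_pairwise_disjoint_open {ι X : Type*} [Finite ι] [MetricSpace X] {S : ι → Set X}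
    (hS : ∀ i, IsCompact (S i)) (hne : ∀ i, (S i).Nonempty)
    (hdisj : Pairwise (Function.onFun Disjoint S)) :
    ∃ V : ι → Set X, (∀ i, IsOpen (V i)) ∧ (∀ i, S i ⊆ V i) ∧
      Pairwise (Function.onFun Disjoint V) := by
  refine ⟨fun i => ⋂ j, {x | j ≠ i → Metric.infDist x (S i) < Metric.infDist x (S j)},
    fun i => isOpen_iInter_of_finite fun j => ?_, fun i x hx => mem_iInter.2 fun j hj => ?_,
    fun i j hij => disjoint_left.2 fun x hxi hxj => ?_⟩
  · by_cases hj : j = i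
    · simp [hj]
    · simpa [hj] using isOpen_lt (Metric.continuous_infDist_pt (S i))
        (Metric.continuous_infDist_pt (S j))
  · rw [Metric.infDist_zero_of_mem hx]
    exact ((hS j).isClosed.notMem_iff_infDist_pos (hne j)).1
      (disjoint_left.1 (hdisj hj.symm) hx)
  · exact lt_asymm (mem_iInter.1 hxi j hij.symm) (mem_iInter.1 hxj i hij)

/-- There is no cyclic pseudo-orbit whose jumps follow pairwise disjoint segments, each contained
in a free open set. -/
lemma no_disjoint_pseudo_cycle (h : ℂ ≃ₜ ℂ) (hd : HasDiffLog h) (hfix : ∀ x, h x ≠ x) {N : ℕ}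
    (hN : 0 < N) {z : ℕ → ℂ} (hz : ∀ i, z (i + N) = z i) {O : Fin N → Set ℂ}
    (hO : ∀ i, IsOpen (O i)) (hzO : ∀ i : Fin N, segment ℝ (h (z i)) (z (i + 1)) ⊆ O i)
    (hfree : ∀ i, ∀ x ∈ O i, h x ∉ O i)
    (hdisj : Pairwise (Function.onFun Disjoint
      fun i : Fin N => segment ℝ (h (z i)) (z (i + 1)))) : False := by
  obtain ⟨V, hV, hSV, hVd⟩ := exists_pairwise_disjoint_open
    (S := fun i : Fin N => segment ℝ (h (z i)) (z (i + 1)))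
    (fun i => by
      rw [segment_eq_image']
      exact isCompact_Icc.image (by fun_prop)) (fun i => ⟨_, left_mem_segment ℝ _ _⟩) hdisj
  obtain ⟨φ, hφ, hφa, hφU, hφx⟩ := exists_push_finset (Finset.univ : Finset (Fin N))
    (U := fun i => O i ∩ V i) (fun i => (hO i).inter (hV i))
    (fun i => subset_inter (hzO i) (hSV i))
    (fun i j hij => (hVd hij).mono inter_subset_right inter_subset_right)
  have hgfix : ∀ x, (h.trans φ) x ≠ x := by
    intro x hx
    rw [Homeomorph.trans_apply] at hx
    by_cases hmem : ∃ i, h x ∈ O i ∩ V i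
    · obtain ⟨i, hi⟩ := hmem
      have := hφU i (Finset.mem_univ i) hi
      rw [hx] at this
      exact hfree i x this.1 hi.1
    · push Not at hmem
      rw [hφx _ fun i _ => hmem i] at hx
      exact hfix x hx
  have hzmod : ∀ i, z (i % N) = z i := fun i => Function.Periodic.map_mod_nat hz i
  have hstep : ∀ i, (h.trans φ) (z i) = z (i + 1) := by
    intro i
    have h1 : φ (h (z (i % N))) = z (i % N + 1) :=
      hφa ⟨i % N, Nat.mod_lt _ hN⟩ (Finset.mem_univ _)
    rw [Homeomorph.trans_apply, ← hzmod i, h1, ← hzmod (i % N + 1), Nat.mod_add_mod, hzmod]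
  have hiter : ∀ n, (h.trans φ)^[n] (z 0) = z n := by
    intro n
    induction n with
    | zero => rfl
    | succ k ih => rw [Function.iterate_succ_apply', ih, hstep]
  refine iterate_ne_self (h.trans φ) (hφ.comp hd h.continuous h.injective) hgfix hN (z 0) ?_
  rw [hiter]
  simpa using hz 0

/-- The landing relation of `δ`-pseudo-orbits that may jump onto points of `C` only. -/
def IsJump (C : Set ℂ) (δ : ℝ) (y x : ℂ) : Prop :=
  y = x ∨ x ∈ C ∧ dist y x < δ

lemma IsJump.exchange {C : Set ℂ} {δ : ℝ} {a b c d w : ℂ} (hab : IsJump C δ a b)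
    (hcd : IsJump C δ c d) (hw : w ∈ segment ℝ a b) (hw' : w ∈ segment ℝ c d) :
    IsJump C δ a d ∨ IsJump C δ c b := by
  have h1 := dist_add_dist_of_mem_segment hw
  have h2 := dist_add_dist_of_mem_segment hw'
  have h3 := dist_triangle a w d
  have h4 := dist_triangle c w b
  rcases hcd with rfl | ⟨hd, hcd⟩
  · rw [segment_same, mem_singleton_iff] at hw'
    subst hw'
    rcases hab with rfl | ⟨hb, hab⟩
    · rw [segment_same, mem_singleton_iff] at hw
      exact Or.inl (Or.inl hw.symm)
    · exact Or.inr (Or.inr ⟨hb, by linarith [dist_nonneg (x := a) (y := w)]⟩)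
  · rcases hab with rfl | ⟨hb, hab⟩
    · rw [segment_same, mem_singleton_iff] at hw
      subst hw
      exact Or.inl (Or.inr ⟨hd, by linarith [dist_nonneg (x := c) (y := w)]⟩)
    · by_cases h5 : dist a d < δ
      · exact Or.inl (Or.inr ⟨hd, h5⟩)
      · exact Or.inr (Or.inr ⟨hb, by linarith⟩)

lemma Relation.TransGen.exists_chain {α : Type*} {R : α → α → Prop} {u v : α}
    (h : Relation.TransGen R u v) :
    ∃ (n : ℕ) (f : ℕ → α), 0 < n ∧ f 0 = u ∧ f n = v ∧ ∀ i < n, R (f i) (f (i + 1)) := by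
  classical
  induction h with
  | single h => exact ⟨1, fun i => if i = 0 then u else _, one_pos, by simp, by simp; rfl, by
      intro i hi
      obtain rfl : i = 0 := by omega
      simpa using h⟩
  | @tail b c _ hbc ih =>
    obtain ⟨n, f, hn, h0, hnb, hR⟩ := ih
    refine ⟨n + 1, fun i => if i ≤ n then f i else c, by omega, by simp [h0], by simp, ?_⟩
    intro i hi
    rcases (Nat.lt_succ_iff.1 hi).eq_or_lt with rfl | h1
    · simpa [hnb] using hbc
    · simpa [h1.le, Nat.succ_le_of_lt h1] using hR i h1

lemma exists_periodic_of_chain {α : Type*} {R : α → α → Prop} {f : ℕ → α} {n : ℕ} (hn : 0 < n)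
    (h : ∀ i, i + 1 < n → R (f i) (f (i + 1))) (hlast : R (f (n - 1)) (f 0)) :
    ∃ z : ℕ → α, (∀ i, z (i + n) = z i) ∧ ∀ i, R (z i) (z (i + 1)) := by
  refine ⟨fun i => f (i % n), fun i => by simp, fun i => ?_⟩
  have h1 := Nat.mod_lt i hn
  rcases (Nat.succ_le_of_lt h1).lt_or_eq with h2 | h2
  · have : (i + 1) % n = i % n + 1 := by
      rw [← Nat.mod_add_mod, Nat.mod_eq_of_lt h2]
    simp only [this]
    exact h _ h2
  · have : (i + 1) % n = 0 := by
      rw [← Nat.mod_add_mod]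
      simp only [Nat.succ_eq_add_one] at h2
      rw [h2, Nat.mod_self]
    simp only [this]
    rwa [show i % n = n - 1 by omega]

/-- A version of Franks' lemma: there are no cyclic pseudo-orbits whose jumps stay within free
balls. -/
lemma not_transGen_isJump (h : ℂ ≃ₜ ℂ) (hd : HasDiffLog h) (hfix : ∀ x, h x ≠ x) {C : Set ℂ}
    {δ : ℝ} (hδ : ∀ c ∈ C, ∀ x ∈ Metric.ball c δ, h x ∉ Metric.ball c δ) (u : ℂ) :
    ¬ Relation.TransGen (fun x y => IsJump C δ (h x) y) u u := by
  intro hu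
  let P : ℕ → Prop := fun N => 0 < N ∧ ∃ z : ℕ → ℂ, (∀ i, z (i + N) = z i) ∧
    ∀ i, IsJump C δ (h (z i)) (z (i + 1))
  have hP : ∃ N, P N := by
    obtain ⟨n, f, hn, h0, h1, hf⟩ := hu.exists_chain
    refine ⟨n, hn, exists_periodic_of_chain (R := fun x y => IsJump C δ (h x) y) hn
      (fun i hi => hf i (by omega)) ?_⟩
    have := hf (n - 1) (by omega)
    rwa [Nat.sub_add_cancel hn, h1, ← h0] at this
  classical
  obtain ⟨hN, z, hz, hzJ⟩ := Nat.find_spec hP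
  have hmin : ∀ m < Nat.find hP, ¬ P m := fun m hm => Nat.find_min hP hm
  generalize Nat.find hP = N at hN hz hmin
  have hshort : ∀ i < N, ∀ j < N, i ≠ j → ¬ IsJump C δ (h (z i)) (z (j + 1)) := by
    intro i hi j hj hij hJ
    obtain ⟨m, hm0, hmN, hm⟩ : ∃ m, 0 < m ∧ m < N ∧ z (j + m) = z i := by
      rcases lt_or_gt_of_ne hij with h1 | h1
      · exact ⟨i + N - j, by omega, by omega, by rw [show j + (i + N - j) = i + N by omega, hz]⟩
      · exact ⟨i - j, by omega, by omega, by rw [show j + (i - j) = i by omega]⟩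
    refine hmin m hmN ⟨hm0, exists_periodic_of_chain (R := fun x y => IsJump C δ (h x) y)
      (f := fun k => z (j + 1 + k)) hm0 (fun k _ => hzJ _) ?_⟩
    simp only [add_zero]
    rwa [show j + 1 + (m - 1) = j + m by omega, hm]
  have hO : ∀ i, ∃ O : Set ℂ, IsOpen O ∧ segment ℝ (h (z i)) (z (i + 1)) ⊆ O ∧
      ∀ x ∈ O, h x ∉ O := by
    intro i
    rcases hzJ i with h1 | ⟨h1, h2⟩
    · obtain ⟨A, B, hA, hB, hxA, hxB, hAB⟩ := t2_separation (hfix (z (i + 1))).symm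
      refine ⟨A ∩ h ⁻¹' B, hA.inter (hB.preimage h.continuous), ?_, fun x hx hx' =>
        disjoint_left.1 hAB hx'.1 hx.2⟩
      rw [h1, segment_same, singleton_subset_iff]
      exact ⟨hxA, hxB⟩
    · have hpos : 0 < δ := dist_nonneg.trans_lt h2
      exact ⟨Metric.ball (z (i + 1)) δ, Metric.isOpen_ball,
        (convex_ball _ _).segment_subset h2 (Metric.mem_ball_self hpos), hδ _ h1⟩
  choose O hOo hOs hOf using hO
  refine no_disjoint_pseudo_cycle h hd hfix hN hz (O := fun i => O i) (fun i => hOo i)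
    (fun i => hOs i) (fun i => hOf i) fun i j hij => disjoint_left.2 fun w hwi hwj => ?_
  have hij' : (i : ℕ) ≠ j := fun h => hij (Fin.ext h)
  rcases (hzJ i).exchange (hzJ j) hwi hwj with h1 | h1
  · exact hshort i i.2 j j.2 hij' h1
  · exact hshort j j.2 i i.2 hij'.symm h1

/-- On a compact set, balls of some uniform radius are free. -/
lemma exists_free_radius {h : ℂ → ℂ} (hc : Continuous h) (hfix : ∀ x, h x ≠ x) {C : Set ℂ}
    (hC : IsCompact C) :
    ∃ δ > 0, ∀ c ∈ C, ∀ x ∈ Metric.ball c δ, h x ∉ Metric.ball c δ := by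
  obtain ⟨m, hm, hmC⟩ := (hC.cthickening (r := 1)).exists_forall_le' (f := fun x => dist (h x) x)
    (a := 0) (by fun_prop) fun x _ => dist_pos.2 (hfix x)
  refine ⟨min 1 (m / 2), by positivity, fun c hcC x hx hhx => ?_⟩
  rw [Metric.mem_ball, lt_min_iff] at hx hhx
  have h1 := hmC x (Metric.mem_cthickening_of_dist_le x c 1 C hcC hx.1.le)
  have h2 := dist_triangle_right (h x) x c
  linarith

/-- A nonempty compact set is not contained in the limit superior of its forward iterates: its
points cannot all be approached by positive iterates of its points. -/
lemma not_forall_exists_iterate_dist_lt (h : ℂ ≃ₜ ℂ) (hd : HasDiffLog h)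
    (hfix : ∀ x, h x ≠ x) {C : Set ℂ} (hC : IsCompact C) (hne : C.Nonempty) :
    ¬ ∀ x ∈ C, ∀ ε > 0, ∃ c ∈ C, ∃ n > 0, dist (h^[n] c) x < ε := by
  intro H
  obtain ⟨δ, hδ, hfree⟩ := exists_free_radius h.continuous hfix hC
  set R : ℂ → ℂ → Prop := fun x y => IsJump C δ (h x) y with hR
  choose g hgC n hn hg using fun x : C => H x x.2 (δ / 2) (half_pos hδ)
  have horbit : ∀ (k : ℕ) (c y : ℂ), y ∈ C → dist (h^[k + 1] c) y < δ → Relation.TransGen R c y := by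
    intro k
    induction k with
    | zero => exact fun c y hy hcy => .single (Or.inr ⟨hy, hcy⟩)
    | succ k ih => exact fun c y hy hcy => .head (Or.inl rfl) (ih (h c) y hy hcy)
  have hjump : ∀ x : C, ∀ y ∈ C, dist (x : ℂ) y < δ / 2 → Relation.TransGen R (g x) y := by
    intro x y hy hxy
    refine horbit (n x - 1) _ y hy ?_
    rw [Nat.sub_add_cancel (hn x)]
    linarith [dist_triangle (h^[n x] (g x)) x y, hg x]
  obtain ⟨x₀, hx₀⟩ := hne
  let x : ℕ → C := fun k => (fun y : C => (⟨g y, hgC y⟩ : C))^[k] ⟨x₀, hx₀⟩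
  have hx : ∀ k, (x (k + 1) : ℂ) = g (x k) := fun k => by
    simp only [x, Function.iterate_succ_apply']
  have hstep : ∀ k, Relation.TransGen R (x (k + 1)) (x k) := fun k => by
    rw [hx]
    exact hjump (x k) _ (x k).2 (by simpa using half_pos hδ)
  have hchain : ∀ i k, Relation.ReflTransGen R (x (i + k)) (x i) := by
    intro i k
    induction k with
    | zero => exact .refl
    | succ k ih => exact (hstep (i + k)).to_reflTransGen.trans ih
  obtain ⟨a, -, ψ, hψ, hlim⟩ := hC.tendsto_subseq (x := fun k => (x k : ℂ)) fun k => (x k).2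
  obtain ⟨K, hK⟩ := Metric.cauchySeq_iff.1 hlim.cauchySeq (δ / 2) (half_pos hδ)
  have hlt : ψ K < ψ (K + 1) := hψ (Nat.lt_succ_self K)
  have hclose := hK K le_rfl (K + 1) (Nat.le_succ K)
  have h1 := hjump (x (ψ K)) _ (x (ψ (K + 1))).2 hclose
  rw [← hx] at h1
  have h2 := hchain (ψ K + 1) (ψ (K + 1) - (ψ K + 1))
  rw [Nat.add_sub_cancel' hlt] at h2
  exact not_transGen_isJump h hd hfix hfree _ (h1.trans_left h2)

/-- For a nonempty compact subset `C` of the plane, the topological limit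
superior of the sequence `(h^n(C))_{n ≥ 0}` does not contain `C`. -/
theorem limsup_not_contain_compact (h : BrouwerHomeo) (C : Set Plane)
    (hC : IsCompact C) (hne : C.Nonempty) :
    ¬ C ⊆ limsupSet (fun n : ℕ => h.iter n '' C) := by
  intro hsub
  let e : Plane ≃ₜ ℂ := Complex.equivRealProdCLM.symm.toHomeomorph
  let f : ℂ ≃ₜ ℂ := (e.symm.trans h.toHomeomorph).trans e
  have hf : ∀ x, f (e x) = e (h.toHomeomorph x) := fun x => by simp [f]
  have hfix : ∀ x, f x ≠ x := by
    intro x hx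
    obtain ⟨y, rfl⟩ := e.surjective x
    rw [hf] at hx
    exact h.fixedPointFree y (e.injective hx)
  have hd : HasDiffLog f := by
    obtain ⟨H, hHc, hH0, hH1⟩ := h.orientationPreserving
    have := hasDiffLog_of_isotopy (fun t x => e (H t (e.symm x)))
      (e.continuous.comp (hHc.comp (f := fun p : unitInterval × ℂ => ((p.1 : ℝ), e.symm p.2))
        (by fun_prop)))
      (fun t => e.injective.comp ((H t).injective.comp e.symm.injective))
      (fun x => by simp [hH0])
    simp only [Set.Icc.coe_one, hH1] at this
    exact this
  have hiter : ∀ (n : ℕ) (x : Plane), f^[n] (e x) = e (h.iter n x) := by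
    intro n x
    rw [BrouwerHomeo.iter, zpow_natCast]
    induction n with
    | zero => rfl
    | succ k ih =>
      rw [Function.iterate_succ_apply', ih, hf, pow_succ']
      rfl
  refine not_forall_exists_iterate_dist_lt f hd hfix (hC.image e.continuous) (hne.image e) ?_
  rintro _ ⟨x, hx, rfl⟩ ε hε
  obtain ⟨n, ⟨_, ⟨c, hc, rfl⟩, hcx⟩, hn⟩ := (hsub hx (e ⁻¹' Metric.ball (e x) ε)
    (e.continuous.continuousAt.preimage_mem_nhds (Metric.ball_mem_nhds _ hε))).exists_gt 0
  exact ⟨e c, mem_image_of_mem e hc, n, hn, by rw [hiter]; exact hcx⟩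
end

section
/- Let h be a Brouwer homeomorphism and D a closed topological disk which is free. Then the sequence (h^n(D))_{n ≥ 0} converges in the Hausdorff topology on the space of nonempty compact subsets of the one-point compactification ℝ² ∪ {∞}. -/
open Set Filter Topology

/-- Convergence of a sequence of compact subsets of the sphere `ℝ² ∪ {∞}` to a set `L`,
in the Hausdorff sense (on the space of nonempty compact subsets of a compact metrizable
space this is exactly convergence for the Hausdorff metric): eventually the terms are
contained in any open set containing `L`, and eventually meet any open set meeting `L`. -/
def HausdorffConvergesTo (A : ℕ → Set (OnePoint Plane)) (L : Set (OnePoint Plane)) : Prop :=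
  (∀ U : Set (OnePoint Plane), IsOpen U → L ⊆ U → ∀ᶠ n in Filter.atTop, A n ⊆ U) ∧
  (∀ U : Set (OnePoint Plane), IsOpen U → (L ∩ U).Nonempty →
    ∀ᶠ n in Filter.atTop, (A n ∩ U).Nonempty)

open Metric

/-! ### Isotopies -/

theorem IsotopicToId.trans {f g : Plane ≃ₜ Plane} (hf : IsotopicToId f) (hg : IsotopicToId g) :
    IsotopicToId (f.trans g) := by
  obtain ⟨F, hF, hF0, hF1⟩ := hf
  obtain ⟨G, hG, hG0, hG1⟩ := hg
  refine ⟨fun t => (F t).trans (G t), ?_, ?_, ?_⟩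
  · exact hG.comp (continuous_fst.prodMk hF)
  · ext1 p; simp [hF0, hG0]
  · simp [hF1, hG1]

/-- A small Lipschitz perturbation of the identity moves the centre of a ball to any given point
of that ball. -/
theorem exists_isotopicToId_ball (c v : Plane) (r : ℝ) (hv : ‖v‖ < r) :
    ∃ φ : Plane ≃ₜ Plane, IsotopicToId φ ∧ (∀ p ∉ ball c r, φ p = p) ∧ φ c = c + v := by
  have hr : 0 < r := (norm_nonneg v).trans_lt hv
  let b : Plane → ℝ := fun p => max 0 (1 - ‖p - c‖ / r)
  have hb : Continuous b := by fun_prop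
  have hbL : ∀ p q, |b p - b q| ≤ ‖p - q‖ / r := by
    intro p q
    calc |b p - b q| ≤ |(1 - ‖p - c‖ / r) - (1 - ‖q - c‖ / r)| := by
          simpa [b, max_comm] using abs_max_sub_max_le_abs (1 - ‖p - c‖ / r) (1 - ‖q - c‖ / r) 0
      _ = |‖q - c‖ - ‖p - c‖| / r := by
          rw [← abs_of_pos hr, ← abs_div, abs_of_pos hr]; congr 1; ring
      _ ≤ ‖p - q‖ / r := by
          gcongr
          have := abs_norm_sub_norm_le (q - c) (p - c)
          exact this.trans_eq (by rw [sub_sub_sub_cancel_right, norm_sub_rev])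
  let s : ℝ → ℝ := fun t => max 0 (min t 1)
  have hs : Continuous s := by fun_prop
  have hs0 : ∀ t, 0 ≤ s t := fun t => le_max_left _ _
  have hs1 : ∀ t, s t ≤ 1 := fun t => by simp [s]
  let F : ℝ → Plane → Plane := fun t p => p + (s t * b p) • v
  let k : NNReal := ⟨‖v‖ / r, by positivity⟩
  have hk : k < 1 := by
    rw [← NNReal.coe_lt_coe]; exact (div_lt_one hr).2 hv
  have hF : ∀ t, ApproximatesLinearOn (F t)
      ((ContinuousLinearEquiv.refl ℝ Plane : Plane ≃L[ℝ] Plane) : Plane →L[ℝ] Plane) univ k := by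
    intro t p _ q _
    have : F t p - F t q - (p - q) = (s t * (b p - b q)) • v := by
      simp only [F]; rw [mul_sub, sub_smul]; abel
    simp only [ContinuousLinearEquiv.coe_refl, ContinuousLinearMap.coe_id', id]
    rw [this, norm_smul, Real.norm_eq_abs, abs_mul, abs_of_nonneg (hs0 t)]
    calc s t * |b p - b q| * ‖v‖ ≤ 1 * (‖p - q‖ / r) * ‖v‖ := by
          gcongr
          · exact hs1 t
          · exact hbL p q
      _ = k * ‖p - q‖ := by
          change _ = ‖v‖ / r * ‖p - q‖
          ring
  have hc : Subsingleton Plane ∨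
      k < ‖((ContinuousLinearEquiv.refl ℝ Plane).symm : Plane →L[ℝ] Plane)‖₊⁻¹ := by
    right
    simpa using hk
  let H : ℝ → Plane ≃ₜ Plane := fun t => (hF t).toHomeomorph (F t) hc
  have hH : ∀ t p, H t p = p + (s t * b p) • v := fun t p => rfl
  refine ⟨H 1, ⟨H, ?_, ?_, rfl⟩, ?_, ?_⟩
  · simp only [hH]; fun_prop
  · ext1 p; simp [hH, s]
  · intro p hp
    have : b p = 0 := by
      have : r ≤ ‖p - c‖ := by simpa [dist_eq_norm] using hp
      simpa [b] using (one_le_div hr).2 this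
    simp [hH, this]
  · simp [hH, s, b]

/-- A point of a preconnected set is moved to any other one by an isotopy supported in any prescribed
neighbourhood of that set. -/
theorem IsPreconnected.exists_isotopicToId {K W : Set Plane} (hK : IsPreconnected K)
    (hW : IsOpen W) (hKW : K ⊆ W) {x y : Plane} (hx : x ∈ K) (hy : y ∈ K) :
    ∃ φ : Plane ≃ₜ Plane, IsotopicToId φ ∧ (∀ p ∉ W, φ p = p) ∧ φ x = y := by
  refine hK.induction₂'
    (fun x y => ∃ φ : Plane ≃ₜ Plane, IsotopicToId φ ∧ (∀ p ∉ W, φ p = p) ∧ φ x = y)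
    ?_ ?_ hx hy
  · intro x hx
    obtain ⟨ε, hε, hball⟩ := Metric.isOpen_iff.1 hW x (hKW hx)
    have key : ∀ a b, dist b a < ε / 2 → ball a (ε / 2) ⊆ W →
        ∃ φ : Plane ≃ₜ Plane, IsotopicToId φ ∧ (∀ p ∉ W, φ p = p) ∧ φ a = b := by
      intro a b hab haW
      obtain ⟨φ, h1, h2, h3⟩ := exists_isotopicToId_ball a (b - a) (ε / 2)
        (by rwa [← dist_eq_norm])
      exact ⟨φ, h1, fun p hp => h2 p fun h => hp (haW h), by simpa using h3⟩
    filter_upwards [mem_nhdsWithin_of_mem_nhds (ball_mem_nhds x (half_pos hε))] with y hy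
    refine ⟨key x y hy ((ball_subset_ball (by linarith)).trans hball),
      key y x (by rw [dist_comm]; exact hy) ((ball_subset_ball' ?_).trans hball)⟩
    have : dist y x < ε / 2 := hy
    linarith
  · rintro a b c - - - ⟨φ, h1, h2, h3⟩ ⟨ψ, h4, h5, h6⟩
    refine ⟨φ.trans ψ, h1.trans h4, fun p hp => ?_, ?_⟩
    · simp [h2 p hp, h5 p hp]
    · simp [h3, h6]

/-! ### Points of period two -/

theorem exists_continuous_exp_eq {X : Type*} [TopologicalSpace X] [SimplyConnectedSpace X]
    [LocallyPathConnectedSpace X] {g : X → ℂ} (hg : Continuous g) (h0 : ∀ x, g x ≠ 0) :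
    ∃ f : X → ℂ, Continuous f ∧ ∀ x, Complex.exp (f x) = g x := by
  obtain ⟨x₀⟩ : Nonempty X := inferInstance
  obtain ⟨f, ⟨-, hf⟩, -⟩ := Complex.isCoveringMapOn_exp.existsUnique_continuousMap_lifts
    ⟨g, hg⟩ (Complex.exp_log (h0 x₀)) h0
  exact ⟨f, f.continuous, fun x => congrFun hf x⟩

theorem eq_of_exp_const {X : Type*} [TopologicalSpace X] [PreconnectedSpace X] {f : X → ℂ}
    (hf : Continuous f) (h : ∀ x y, Complex.exp (f x) = Complex.exp (f y)) (x y : X) :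
    f x = f y :=
  Complex.isCoveringMap_exp.const_of_comp hf (fun a b => Subtype.ext (h a b)) x y

/-- A fixed point free homeomorphism of the plane that is isotopic to the identity has no point of
period two. -/
theorem IsotopicToId.apply_apply_ne {f : Plane ≃ₜ Plane} (hf : IsotopicToId f)
    (hfix : ∀ p, f p ≠ p) (x : Plane) : f (f x) ≠ x := by
  intro hx
  obtain ⟨H, hH, hH0, hH1⟩ := hf
  let e : Plane ≃L[ℝ] ℂ := Complex.equivRealProdCLM.symm
  let G : ℝ × Plane → ℂ := fun q => e (H q.1 (f q.2)) - e (H q.1 q.2)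
  have hG : Continuous G := by
    have h1 : Continuous fun q : ℝ × Plane => H q.1 (f q.2) :=
      hH.comp (continuous_fst.prodMk (f.continuous.comp continuous_snd))
    exact (e.continuous.comp h1).sub (e.continuous.comp hH)
  have hG0 : ∀ q, G q ≠ 0 := fun q h =>
    hfix q.2 ((H q.1).injective (e.injective (sub_eq_zero.1 h)))
  obtain ⟨Λ, hΛ, hexp⟩ := exists_continuous_exp_eq hG hG0
  have hA : ∀ p q, Λ (1, p) - Λ (0, f p) = Λ (1, q) - Λ (0, f q) := by
    have hc : ∀ p, Complex.exp (Λ (1, p) - Λ (0, f p)) = 1 := fun p => by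
      rw [Complex.exp_sub, hexp, hexp, div_eq_one_iff_eq (hG0 _)]
      simp [G, hH0, hH1]
    have hcont : Continuous fun p : Plane => Λ (1, p) - Λ (0, f p) :=
      (hΛ.comp (continuous_const.prodMk continuous_id)).sub
        (hΛ.comp (continuous_const.prodMk f.continuous))
    exact eq_of_exp_const hcont fun p q => by rw [hc, hc]
  have hneg : ∀ t, Complex.exp (Λ (t, f x) - Λ (t, x)) = -1 := fun t => by
    have : G (t, f x) = -G (t, x) := by simp [G, hx]
    rw [Complex.exp_sub, hexp, hexp, this, neg_div, div_self (hG0 _)]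
  have hB : Λ (1, f x) - Λ (1, x) = Λ (0, f x) - Λ (0, x) := by
    have hcont : Continuous fun t : ℝ => Λ (t, f x) - Λ (t, x) :=
      (hΛ.comp (continuous_id.prodMk continuous_const)).sub
        (hΛ.comp (continuous_id.prodMk continuous_const))
    exact eq_of_exp_const hcont (fun s t => by rw [hneg, hneg]) 1 0
  have hA' := hA x (f x)
  rw [hx] at hA'
  have hd : Λ (0, f x) - Λ (0, x) = 0 := by linear_combination -(hA' + hB) / 2
  have := hneg 0
  rw [hd, Complex.exp_zero] at this
  norm_num at this

/-! ### Modifying a homeomorphism on free sets -/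

theorem iterate_eq_of_apply_eq {α : Type*} {f g : α → α} {x : α} {n : ℕ}
    (h : ∀ i < n, g (f^[i] x) = f^[i + 1] x) : g^[n] x = f^[n] x := by
  induction n with
  | zero => rfl
  | succ n ih =>
    rw [Function.iterate_succ_apply', ih fun i hi => h i (hi.trans n.lt_succ_self),
      h n n.lt_succ_self]

/-- An injective map supported in `S` preserves `S`. -/
theorem mem_iff_of_apply_eq {α : Type*} {θ : α → α} (hθ : Function.Injective θ) {S : Set α}
    (h : ∀ p ∉ S, θ p = p) (p : α) : θ p ∈ S ↔ p ∈ S := by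
  refine ⟨fun h1 => by_contra fun h2 => h2 (h p h2 ▸ h1), fun h1 => by_contra fun h2 => h2 ?_⟩
  rwa [hθ (h _ h2)]

theorem exists_isOpen_forall_notMem {X : Type*} [TopologicalSpace X] [T2Space X] {f : X → X}
    (hf : Continuous f) {K L : Set X} (hK : IsCompact K) (hL : IsCompact L)
    (h : ∀ p ∈ K, f p ∉ L) :
    ∃ U V, IsOpen U ∧ IsOpen V ∧ K ⊆ U ∧ L ⊆ V ∧ ∀ p ∈ U, f p ∉ V := by
  obtain ⟨A, B, hA, hB, hKA, hLB, hAB⟩ := SeparatedNhds.of_isCompact_isCompact (hK.image hf) hL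
    (Set.disjoint_left.2 (by rintro _ ⟨p, hp, rfl⟩; exact h p hp))
  exact ⟨f ⁻¹' A, B, hA.preimage hf, hB, image_subset_iff.1 hKA, hLB,
    fun p hp hpB => Set.disjoint_left.1 hAB hp hpB⟩

theorem exists_isOpen_free {X : Type*} [TopologicalSpace X] [T2Space X] {f : X → X}
    (hf : Continuous f) {K : Set X} (hK : IsCompact K) (h : ∀ p ∈ K, f p ∉ K) :
    ∃ U, IsOpen U ∧ K ⊆ U ∧ ∀ p ∈ U, f p ∉ U := by
  obtain ⟨U, V, hU, hV, hKU, hKV, hUV⟩ := exists_isOpen_forall_notMem hf hK hK h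
  exact ⟨U ∩ V, hU.inter hV, subset_inter hKU hKV, fun p hp hfp => hUV p hp.1 hfp.2⟩

/-- Closing an orbit segment that returns to a free set. -/
theorem IsotopicToId.exists_iterate_eq_self {f : Plane ≃ₜ Plane} (hf : IsotopicToId f)
    (hfix : ∀ p, f p ≠ p) {K W : Set Plane} (hK : IsPreconnected K) (hW : IsOpen W) (hKW : K ⊆ W)
    (hfree : ∀ p ∈ W, f p ∉ W) {z : Plane} {m : ℕ} (hm : 1 ≤ m) (hz : z ∈ K) (hfz : f^[m] z ∈ K)
    (hmid : ∀ j, 1 ≤ j → j < m → f^[j] z ∉ W) :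
    ∃ g : Plane ≃ₜ Plane, IsotopicToId g ∧ (∀ p, g p ≠ p) ∧ g^[m] z = z := by
  obtain ⟨φ, h1, h2, h3⟩ := hK.exists_isotopicToId hW hKW hfz hz
  refine ⟨f.trans φ, hf.trans h1, fun p hp => ?_, ?_⟩
  · simp only [Homeomorph.trans_apply] at hp
    by_cases h : f p ∈ W
    · have h' := (mem_iff_of_apply_eq φ.injective h2 _).2 h
      rw [hp] at h'
      exact hfree p h' h
    · exact hfix p ((h2 _ h).symm.trans hp)
  · obtain ⟨m, rfl⟩ : ∃ k, m = k + 1 := ⟨m - 1, by omega⟩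
    rw [Function.iterate_succ_apply', iterate_eq_of_apply_eq (f := f)]
    · rw [Homeomorph.trans_apply, ← Function.iterate_succ_apply' f, h3]
    · intro i hi
      rw [Homeomorph.trans_apply, ← Function.iterate_succ_apply' f,
        h2 _ (hmid _ (by omega) (by omega))]

theorem Convex.segment_subset_insert {U : Set Plane} (hU : Convex ℝ U) (ho : IsOpen U)
    {a b : Plane} (ha : a ∈ U) (hb : b ∈ closure U) : segment ℝ a b ⊆ insert b U := by
  rw [← insert_endpoints_openSegment]
  have := hU.openSegment_interior_closure_subset_interior (ho.interior_eq.symm ▸ ha) hb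
  rw [ho.interior_eq] at this
  rintro p (rfl | rfl | hp)
  exacts [Or.inr ha, Or.inl rfl, Or.inr (this hp)]

theorem isCompact_segment (a b : Plane) : IsCompact (segment ℝ a b) := by
  rw [segment_eq_image_lineMap]
  exact isCompact_Icc.image AffineMap.lineMap_continuous

/-- Shortening a recurrent orbit by one step, using a free open convex set `U` whose boundary
contains some point together with its image. -/
theorem IsotopicToId.exists_iterate_pred_eq_self {f : Plane ≃ₜ Plane} (hf : IsotopicToId f)
    (hfix : ∀ p, f p ≠ p) {U : Set Plane} (hU : IsOpen U) (hUc : Convex ℝ U) {v z : Plane}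
    (hv : v ∈ closure U) (hfv : f v ∈ closure U) (hfv' : f v ∉ U) (hz : z ∈ U)
    {m : ℕ} (hm : 3 ≤ m) (hfz : f^[m] z ∈ U)
    (hmin : ∀ j, 1 ≤ j → j < m → ∀ p ∈ U, f^[j] p ∉ U) :
    ∃ g : Plane ≃ₜ Plane, IsotopicToId g ∧ (∀ p, g p ≠ p) ∧ ∃ x, g^[m - 1] x = x := by
  have hcl : ∀ j, 1 ≤ j → j < m → ∀ p ∈ U, f^[j] p ∉ closure U := by
    intro j h1 h2 p hp hpc
    let e : Plane ≃ₜ Plane := f ^ j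
    have he : ⇑e = f^[j] := by
      ext1 q
      exact congrFun (hom_coe_pow (fun g : Plane ≃ₜ Plane => ⇑g) rfl (fun _ _ => rfl) f j) q
    have ho : IsOpen (f^[j] '' U) := he ▸ e.isOpenMap U hU
    obtain ⟨_, ⟨q, hq, rfl⟩, hqU⟩ := _root_.mem_closure_iff.1 hpc _ ho (mem_image_of_mem _ hp)
    exact hmin j h1 h2 q hq hqU
  have hcl' : ∀ p ∈ closure U, f p ∉ U := by
    intro p hp hpU
    obtain ⟨q, hq, hqU⟩ := _root_.mem_closure_iff.1 hp _ (hU.preimage f.continuous) hpU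
    exact hmin 1 le_rfl (by omega) q hqU hq
  set y := f^[m] z with hy
  set w := f v with hw
  set K₁ := segment ℝ y w
  set K := segment ℝ z v
  have hK₁ : K₁ ⊆ insert w U := hUc.segment_subset_insert hU hfz hfv
  have hK : K ⊆ insert v U := hUc.segment_subset_insert hU hz hv
  have hK₁cl : K₁ ⊆ closure U := hK₁.trans (insert_subset hfv subset_closure)
  have hKcl : K ⊆ closure U := hK.trans (insert_subset hv subset_closure)
  have hfw : f w ∉ K₁ := fun h => by
    rcases hK₁ h with h | h
    · exact hfix _ h
    · exact hcl' _ hfv h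
  have ha : ∀ p ∈ K₁, f p ∉ K₁ := by
    intro p hp hfp
    rcases hK₁ hp with rfl | hpU
    · exact hfw hfp
    · exact hcl 1 le_rfl (by omega) p hpU (hK₁cl hfp)
  have hb : ∀ p ∈ f '' K, f p ∉ f '' K := by
    rintro _ ⟨p, hp, rfl⟩ hfp
    rw [f.injective.mem_set_image] at hfp
    rcases hK hp with rfl | hpU
    · rcases hK hfp with h | h
      · exact hfix _ h
      · exact hfv' h
    · exact hcl 1 le_rfl (by omega) p hpU (hKcl hfp)
  have hc : ∀ p ∈ f '' K, f p ∉ K₁ := by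
    rintro _ ⟨p, hp, rfl⟩ hfp
    rcases hK hp with rfl | hpU
    · exact hfw hfp
    · exact hcl 2 (by omega) (by omega) p hpU (hK₁cl hfp)
  have hd₁ : ∀ j, 1 < j → j < m → f^[j] z ∉ K₁ := fun j h1 h2 h =>
    hcl j h1.le h2 z hz (hK₁cl h)
  have hd₂ : ∀ j, 1 < j → j < m → f^[j] z ∉ f '' K := by
    intro j h1 h2 h
    obtain ⟨i, rfl⟩ : ∃ i, j = i + 1 := ⟨j - 1, by omega⟩
    rw [Function.iterate_succ_apply', f.injective.mem_set_image] at h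
    exact hcl i (by omega) (by omega) z hz (hKcl h)
  have hK₁k : IsCompact K₁ := isCompact_segment _ _
  have hKk : IsCompact (f '' K) := (isCompact_segment _ _).image f.continuous
  have hK₁p : IsPreconnected K₁ := (convex_segment _ _).isPreconnected
  have hKp : IsPreconnected (f '' K) :=
    (convex_segment _ _).isPreconnected.image _ f.continuous.continuousOn
  obtain ⟨A, hA, hKA, hAf⟩ := exists_isOpen_free f.continuous hK₁k ha
  obtain ⟨B, hB, hKB, hBf⟩ := exists_isOpen_free f.continuous hKk hb
  obtain ⟨B', A', hB', hA', hKB', hKA', hBA⟩ :=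
    exists_isOpen_forall_notMem f.continuous hKk hK₁k hc
  set F := (fun j => f^[j] z) '' Ioo 1 m with hF
  have hFo : IsOpen Fᶜ := ((finite_Ioo 1 m).image _).isClosed.isOpen_compl
  have hKF₁ : K₁ ⊆ Fᶜ := by
    rintro p hp ⟨j, hj, rfl⟩
    exact hd₁ j hj.1 hj.2 hp
  have hKF₂ : f '' K ⊆ Fᶜ := by
    rintro p hp ⟨j, hj, rfl⟩
    exact hd₂ j hj.1 hj.2 hp
  obtain ⟨φ, hφ, hφs, hφy⟩ := hK₁p.exists_isotopicToId ((hA.inter hA').inter hFo)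
    (subset_inter (subset_inter hKA hKA') hKF₁) (left_mem_segment ℝ y w) (right_mem_segment ℝ y w)
  obtain ⟨ψ, hψ, hψs, hψw⟩ := hKp.exists_isotopicToId ((hB.inter hB').inter hFo)
    (subset_inter (subset_inter hKB hKB') hKF₂)
    (mem_image_of_mem f (right_mem_segment ℝ z v)) (mem_image_of_mem f (left_mem_segment ℝ z v))
  refine ⟨(f.trans φ).trans ψ, (hf.trans hφ).trans hψ, fun p hp => ?_, f z, ?_⟩
  · simp only [Homeomorph.trans_apply] at hp
    by_cases h1 : φ (f p) ∈ (B ∩ B') ∩ Fᶜ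
    · have hpB : p ∈ (B ∩ B') ∩ Fᶜ := by
        rw [← mem_iff_of_apply_eq ψ.injective hψs, hp] at h1; exact h1
      by_cases h2 : f p ∈ (A ∩ A') ∩ Fᶜ
      · exact hBA p hpB.1.2 h2.1.2
      · rw [hφs _ h2] at h1
        exact hBf p hpB.1.1 h1.1.1
    · rw [hψs _ h1] at hp
      by_cases h2 : f p ∈ (A ∩ A') ∩ Fᶜ
      · have h3 := (mem_iff_of_apply_eq φ.injective hφs _).2 h2
        rw [hp] at h3
        exact hAf p h3.1.1 h2.1.1
      · exact hfix p ((hφs _ h2).symm.trans hp)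
  · obtain ⟨k, rfl⟩ : ∃ k, m = k + 2 := ⟨m - 2, by omega⟩
    rw [show k + 2 - 1 = k + 1 by omega, Function.iterate_succ_apply',
      iterate_eq_of_apply_eq (f := f)]
    · simp only [Homeomorph.trans_apply]
      rw [← Function.iterate_succ_apply' f, ← Function.iterate_succ_apply f, ← hy, hφy, hψw]
    · intro i hi
      simp only [Homeomorph.trans_apply]
      rw [← Function.iterate_succ_apply' f, ← Function.iterate_succ_apply f]
      have hmem : f^[i + 1 + 1] z ∈ F := ⟨i + 1 + 1, ⟨by omega, by omega⟩, rfl⟩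
      rw [hφs _ fun h => h.2 hmem, hψs _ fun h => h.2 hmem]

/-! ### Brouwer's theorem -/

/-- The largest free ball centred at a point which is not fixed. -/
theorem exists_critical_ball {f : Plane ≃ₜ Plane} {x : Plane} (hx : f x ≠ x) :
    ∃ R > 0, (∀ p ∈ ball x R, f p ∉ ball x R) ∧
      ∃ v ∈ closedBall x R, f v ∈ closedBall x R := by
  set S := {r : ℝ | ∀ p ∈ ball x r, f p ∉ ball x r}
  have hbdd : ∀ r ∈ S, r ≤ dist (f x) x := by
    intro r hr
    by_contra! h
    exact hr x (mem_ball_self (dist_nonneg.trans_lt h)) h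
  have hpos : ∃ r ∈ S, 0 < r := by
    obtain ⟨W, hW, hxW, hWf⟩ := exists_isOpen_free f.continuous (isCompact_singleton (x := x))
      (by rintro p rfl; exact hx)
    obtain ⟨ε, hε, hball⟩ := Metric.isOpen_iff.1 hW x (hxW rfl)
    exact ⟨ε, fun p hp hfp => hWf p (hball hp) (hball hfp), hε⟩
  obtain ⟨r₀, hr₀, hr₀'⟩ := hpos
  have hB : BddAbove S := ⟨_, hbdd⟩
  have hR : 0 < sSup S := hr₀'.trans_le (le_csSup hB hr₀)
  refine ⟨sSup S, hR, fun p hp hfp => ?_, ?_⟩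
  · obtain ⟨r, hr, hlt⟩ := exists_lt_of_lt_csSup ⟨r₀, hr₀⟩ (max_lt hp hfp)
    exact hr p ((le_max_left _ _).trans_lt hlt) ((le_max_right _ _).trans_lt hlt)
  · by_contra! h
    obtain ⟨W, hW, hxW, hWf⟩ := exists_isOpen_free f.continuous (isCompact_closedBall x (sSup S)) h
    obtain ⟨δ, hδ, hδW⟩ := (isCompact_closedBall x (sSup S)).exists_thickening_subset_open hW hxW
    rw [thickening_closedBall hδ hR.le] at hδW
    have : δ + sSup S ∈ S := fun p hp hfp => hWf p (hδW hp) (hδW hfp)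
    linarith [le_csSup hB this]

/-- **Brouwer's theorem**: a fixed point free homeomorphism of the plane that is isotopic to the
identity has no periodic point. -/
theorem IsotopicToId.iterate_ne {f : Plane ≃ₜ Plane} (hf : IsotopicToId f)
    (hfix : ∀ p, f p ≠ p) {n : ℕ} (hn : 1 ≤ n) (x : Plane) : f^[n] x ≠ x := by
  induction n using Nat.strong_induction_on generalizing f x with
  | _ n ih =>
  intro hx
  obtain ⟨R, hR, hfree, v, hv, hfv⟩ := exists_critical_ball (hfix x)
  have hcl : closure (ball x R) = closedBall x R := closure_ball x hR.ne'
  rw [← hcl] at hv hfv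
  have hfv' : f v ∉ ball x R := by
    intro h
    obtain ⟨q, hq, hqU⟩ := _root_.mem_closure_iff.1 hv _ (isOpen_ball.preimage f.continuous) h
    exact hfree q hqU hq
  have hex : ∃ m, 1 ≤ m ∧ ∃ z ∈ ball x R, f^[m] z ∈ ball x R :=
    ⟨n, hn, x, mem_ball_self hR, by rw [hx]; exact mem_ball_self hR⟩
  classical
  obtain ⟨hm1, z, hz, hfz⟩ := Nat.find_spec hex
  have hmn : Nat.find hex ≤ n :=
    Nat.find_le ⟨hn, x, mem_ball_self hR, by rw [hx]; exact mem_ball_self hR⟩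
  have hmin : ∀ j, 1 ≤ j → j < Nat.find hex → ∀ p ∈ ball x R, f^[j] p ∉ ball x R :=
    fun j h1 h2 p hp hfp => Nat.find_min hex h2 ⟨h1, p, hp, hfp⟩
  generalize Nat.find hex = m at *
  have hm2 : m ≠ 1 := by
    rintro rfl
    exact hfree z hz hfz
  by_cases hm3 : m = 2
  · subst hm3
    obtain ⟨g, hg, hgfix, hgz⟩ := hf.exists_iterate_eq_self hfix (convex_ball x R).isPreconnected
      isOpen_ball Subset.rfl hfree hm1 hz hfz fun j h1 h2 => hmin j h1 h2 z hz
    exact hg.apply_apply_ne hgfix z hgz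
  · obtain ⟨g, hg, hgfix, y, hy⟩ := hf.exists_iterate_pred_eq_self hfix isOpen_ball
      (convex_ball x R) hv hfv hfv' hz (by omega) hfz hmin
    exact ih (m - 1) (by omega) hg hgfix (by omega) y hy

/-! ### Franks' lemma -/

/-- A free compact connected set is disjoint from all its iterates. -/
theorem IsotopicToId.iterate_notMem {f : Plane ≃ₜ Plane} (hf : IsotopicToId f)
    (hfix : ∀ p, f p ≠ p) {K : Set Plane} (hK : IsCompact K) (hKp : IsPreconnected K)
    (hfree : ∀ p ∈ K, f p ∉ K) {n : ℕ} (hn : 1 ≤ n) {x : Plane} (hx : x ∈ K) : f^[n] x ∉ K := by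
  intro hfx
  classical
  have hex : ∃ m, 1 ≤ m ∧ f^[m] x ∈ K := ⟨n, hn, hfx⟩
  obtain ⟨hm1, hfz⟩ := Nat.find_spec hex
  have hmin : ∀ j, 1 ≤ j → j < Nat.find hex → f^[j] x ∉ K :=
    fun j h1 h2 hfp => Nat.find_min hex h2 ⟨h1, hfp⟩
  generalize Nat.find hex = m at *
  obtain ⟨W, hW, hKW, hWf⟩ := exists_isOpen_free f.continuous hK hfree
  set F := (fun j => f^[j] x) '' Ico 1 m
  have hFo : IsOpen Fᶜ := ((finite_Ico 1 m).image _).isClosed.isOpen_compl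
  have hKF : K ⊆ Fᶜ := by
    rintro p hp ⟨j, hj, rfl⟩
    exact hmin j hj.1 hj.2 hp
  obtain ⟨g, hg, hgfix, hgz⟩ := hf.exists_iterate_eq_self hfix hKp (hW.inter hFo)
    (subset_inter hKW hKF) (fun p hp hfp => hWf p hp.1 hfp.1) hm1 hx hfz
    fun j h1 h2 h => h.2 ⟨j, ⟨h1, h2⟩, rfl⟩
  exact hg.iterate_ne hgfix hm1 x hgz

/-- There is no periodic chain formed by two disjoint free compact connected sets. -/
theorem IsotopicToId.not_periodic_chain {f : Plane ≃ₜ Plane} (hf : IsotopicToId f)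
    (hfix : ∀ p, f p ≠ p) {K V : Set Plane} (hK : IsCompact K) (hKp : IsPreconnected K)
    (hKfree : ∀ p ∈ K, f p ∉ K) (hV : IsCompact V) (hVp : IsPreconnected V)
    (hVfree : ∀ p ∈ V, f p ∉ V) (hKV : Disjoint K V) {p q : ℕ} (hp : 1 ≤ p) (hq : 1 ≤ q)
    {x y : Plane} (hx : x ∈ K) (hfx : f^[p] x ∈ V) (hy : y ∈ V) : f^[q] y ∉ K := by
  intro hfy
  classical
  have hexp : ∃ m, 1 ≤ m ∧ f^[m] x ∈ V := ⟨p, hp, hfx⟩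
  have hexq : ∃ m, 1 ≤ m ∧ f^[m] y ∈ K := ⟨q, hq, hfy⟩
  obtain ⟨hp', hfx'⟩ := Nat.find_spec hexp
  obtain ⟨hq', hfy'⟩ := Nat.find_spec hexq
  have hminp : ∀ j, 1 ≤ j → j < Nat.find hexp → f^[j] x ∉ V :=
    fun j h1 h2 hfp => Nat.find_min hexp h2 ⟨h1, hfp⟩
  have hminq : ∀ j, 1 ≤ j → j < Nat.find hexq → f^[j] y ∉ K :=
    fun j h1 h2 hfp => Nat.find_min hexq h2 ⟨h1, hfp⟩
  generalize Nat.find hexp = m at *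
  generalize Nat.find hexq = n at *
  obtain ⟨A, hA, hKA, hAf⟩ := exists_isOpen_free f.continuous hK hKfree
  obtain ⟨B, hB, hVB, hBf⟩ := exists_isOpen_free f.continuous hV hVfree
  obtain ⟨A', B', hA', hB', hKA', hVB', hAB⟩ := SeparatedNhds.of_isCompact_isCompact hK hV hKV
  set F := (fun j => f^[j] x) '' Ico 1 m ∪ (fun j => f^[j] y) '' Ico 1 n
  have hFo : IsOpen Fᶜ :=
    (((finite_Ico 1 m).image _).union ((finite_Ico 1 n).image _)).isClosed.isOpen_compl
  have hKF : K ⊆ Fᶜ := by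
    rintro z hz (⟨j, hj, rfl⟩ | ⟨j, hj, rfl⟩)
    · exact hf.iterate_notMem hfix hK hKp hKfree hj.1 hx hz
    · exact hminq j hj.1 hj.2 hz
  have hVF : V ⊆ Fᶜ := by
    rintro z hz (⟨j, hj, rfl⟩ | ⟨j, hj, rfl⟩)
    · exact hminp j hj.1 hj.2 hz
    · exact hf.iterate_notMem hfix hV hVp hVfree hj.1 hy hz
  obtain ⟨φ, hφ, hφs, hφx⟩ := hVp.exists_isotopicToId ((hB.inter hB').inter hFo)
    (subset_inter (subset_inter hVB hVB') hVF) hfx' hy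
  obtain ⟨ψ, hψ, hψs, hψy⟩ := hKp.exists_isotopicToId ((hA.inter hA').inter hFo)
    (subset_inter (subset_inter hKA hKA') hKF) hfy' hx
  set g := (f.trans φ).trans ψ with hg
  have hgfix : ∀ z, g z ≠ z := by
    intro z hz
    simp only [hg, Homeomorph.trans_apply] at hz
    by_cases h1 : f z ∈ (B ∩ B') ∩ Fᶜ
    · have h2 := (mem_iff_of_apply_eq φ.injective hφs _).2 h1
      rw [hψs _ fun h => Set.disjoint_left.1 hAB h.1.2 h2.1.2] at hz
      rw [hz] at h2
      exact hBf z h2.1.1 h1.1.1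
    · rw [hφs _ h1] at hz
      by_cases h2 : f z ∈ (A ∩ A') ∩ Fᶜ
      · have h3 := (mem_iff_of_apply_eq ψ.injective hψs _).2 h2
        rw [hz] at h3
        exact hAf z h3.1.1 h2.1.1
      · exact hfix z ((hψs _ h2).symm.trans hz)
  have hgF : ∀ z, f z ∈ F → g z = f z := fun z hz => by
    simp only [hg, Homeomorph.trans_apply]
    rw [hφs _ fun h => h.2 hz, hψs _ fun h => h.2 hz]
  have hgx : g^[m] x = y := by
    obtain ⟨m, rfl⟩ : ∃ k, m = k + 1 := ⟨m - 1, by omega⟩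
    rw [Function.iterate_succ_apply', iterate_eq_of_apply_eq (f := f)]
    · simp only [hg, Homeomorph.trans_apply]
      rw [← Function.iterate_succ_apply' f, hφx,
        hψs _ fun h => Set.disjoint_left.1 hAB h.1.2 (hVB' hy)]
    · intro i hi
      rw [hgF _ (Or.inl ⟨i + 1, ⟨by omega, by omega⟩, Function.iterate_succ_apply' f i x⟩),
        Function.iterate_succ_apply']
  have hgy : g^[n] y = x := by
    obtain ⟨n, rfl⟩ : ∃ k, n = k + 1 := ⟨n - 1, by omega⟩
    rw [Function.iterate_succ_apply', iterate_eq_of_apply_eq (f := f)]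
    · simp only [hg, Homeomorph.trans_apply]
      rw [← Function.iterate_succ_apply' f,
        hφs _ fun h => Set.disjoint_left.1 hAB (hKA' hfy') h.1.2, hψy]
    · intro i hi
      rw [hgF _ (Or.inr ⟨i + 1, ⟨by omega, by omega⟩, Function.iterate_succ_apply' f i y⟩),
        Function.iterate_succ_apply']
  exact ((hf.trans hφ).trans hψ).iterate_ne hgfix (n := n + m) (by omega) x
    (by rw [Function.iterate_add_apply, hgx, hgy])

/-- The interval version of Franks' lemma for free compact connected sets. -/
theorem IsotopicToId.inter_nonempty_of_between {f : Plane ≃ₜ Plane} (hf : IsotopicToId f)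
    (hfix : ∀ p, f p ≠ p) {D V : Set Plane} (hD : IsCompact D) (hDp : IsPreconnected D)
    (hDfree : ∀ p ∈ D, f p ∉ D) (hV : IsCompact V) (hVp : IsPreconnected V)
    (hVfree : ∀ p ∈ V, f p ∉ V) {a b c : ℕ} (hab : a ≤ b) (hbc : b ≤ c)
    (ha : (f^[a] '' D ∩ V).Nonempty) (hc : (f^[c] '' D ∩ V).Nonempty) :
    (f^[b] '' D ∩ V).Nonempty := by
  by_contra hb
  have hab' : a < b := hab.lt_of_ne (by rintro rfl; exact hb ha)
  have hbc' : b < c := hbc.lt_of_ne (by rintro rfl; exact hb hc)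
  obtain ⟨_, ⟨y, hy, rfl⟩, hyV⟩ := ha
  obtain ⟨_, ⟨x, hx, rfl⟩, hxV⟩ := hc
  have hcont : Continuous f^[b] := f.continuous.iterate b
  refine hf.not_periodic_chain hfix (hD.image hcont) (hDp.image _ hcont.continuousOn) ?_ hV hVp
    hVfree (disjoint_iff_inter_eq_empty.2 (not_nonempty_iff_eq_empty.1 hb)) (p := c - b)
    (q := b - a) (by omega) (by omega) (mem_image_of_mem _ hx) ?_ hyV ?_
  · rintro _ ⟨p, hp, rfl⟩ h
    rw [← Function.iterate_succ_apply' f, Function.iterate_succ_apply f,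
      (f.injective.iterate b).mem_set_image] at h
    exact hDfree p hp h
  · rwa [← Function.iterate_add_apply, Nat.sub_add_cancel hbc]
  · rw [← Function.iterate_add_apply, Nat.sub_add_cancel hab]
    exact mem_image_of_mem _ hy

/-- Every orbit leaves every compact set. -/
theorem IsotopicToId.eventually_notMem {f : Plane ≃ₜ Plane} (hf : IsotopicToId f)
    (hfix : ∀ p, f p ≠ p) {C : Set Plane} (hC : IsCompact C) (x : Plane) :
    ∀ᶠ n in atTop, f^[n] x ∉ C := by
  refine hC.induction_on (p := fun C => ∀ᶠ n in atTop, f^[n] x ∉ C) (by simp)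
    (fun s t hst ht => ht.mono fun n hn h => hn (hst h))
    (fun s t hs ht => ?_) fun y _ => ?_
  · filter_upwards [hs, ht] with n h1 h2 h
    exact h.elim h1 h2
  · obtain ⟨R, hR, hfree, -⟩ := exists_critical_ball (hfix y)
    refine ⟨closedBall y (R / 2), mem_nhdsWithin_of_mem_nhds (closedBall_mem_nhds y (half_pos hR)),
      ?_⟩
    have hsub : closedBall y (R / 2) ⊆ ball y R := closedBall_subset_ball (half_lt_self hR)
    by_cases h : ∃ k, f^[k] x ∈ closedBall y (R / 2)
    · obtain ⟨k, hk⟩ := h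
      filter_upwards [eventually_gt_atTop k] with n hn
      have := hf.iterate_notMem hfix (isCompact_closedBall y (R / 2))
        (convex_closedBall y (R / 2)).isPreconnected
        (fun p hp hfp => hfree p (hsub hp) (hsub hfp)) (n := n - k) (by omega) hk
      rwa [← Function.iterate_add_apply, Nat.sub_add_cancel hn.le] at this
    · push Not at h
      exact Eventually.of_forall h

theorem BrouwerHomeo.iter_natCast (h : BrouwerHomeo) (n : ℕ) :
    h.iter n = h.toHomeomorph^[n] := by
  rw [BrouwerHomeo.iter, zpow_natCast]
  exact (Equiv.Perm.iterate_eq_pow h.toHomeomorph.toEquiv n).symm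

/-- A sequence of nonempty sets in a compact space converges as soon as its upper limit is
contained in its lower limit. -/
theorem exists_hausdorffConvergesTo {A : ℕ → Set (OnePoint Plane)} (hA : ∀ n, (A n).Nonempty)
    (h : ∀ x, (∀ U, IsOpen U → x ∈ U → ∃ᶠ n in atTop, (A n ∩ U).Nonempty) →
      ∀ U, IsOpen U → x ∈ U → ∀ᶠ n in atTop, (A n ∩ U).Nonempty) :
    ∃ L : Set (OnePoint Plane), IsCompact L ∧ L.Nonempty ∧ HausdorffConvergesTo A L := by
  set L := {x | ∀ U, IsOpen U → x ∈ U → ∃ᶠ n in atTop, (A n ∩ U).Nonempty}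
  have hL : IsClosed L := by
    rw [← isOpen_compl_iff, isOpen_iff_forall_mem_open]
    intro x hx
    simp only [L, mem_compl_iff, mem_ofPred_eq, not_forall] at hx
    obtain ⟨U, hU, hxU, hn⟩ := hx
    exact ⟨U, fun y hy hyL => hn (hyL U hU hy), hU, hxU⟩
  have hupper : ∀ U : Set (OnePoint Plane), IsOpen U → L ⊆ U → ∀ᶠ n in atTop, A n ⊆ U := by
    intro U hU hLU
    have key : ∀ᶠ n in atTop, ¬(A n ∩ Uᶜ).Nonempty := by
      refine hU.isClosed_compl.isCompact.induction_on
        (p := fun C => ∀ᶠ n in atTop, ¬(A n ∩ C).Nonempty) (by simp)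
        (fun s t hst ht => ht.mono fun n hn hs => hn (hs.mono (inter_subset_inter_right _ hst)))
        (fun s t hs ht => ?_) fun y hy => ?_
      · filter_upwards [hs, ht] with n h1 h2 h
        rw [inter_union_distrib_left, union_nonempty] at h
        exact h.elim h1 h2
      · have hyL : y ∉ L := fun hyL => hy (hLU hyL)
        simp only [L, mem_ofPred_eq, not_forall] at hyL
        obtain ⟨W, hW, hyW, hn⟩ := hyL
        exact ⟨W, mem_nhdsWithin_of_mem_nhds (hW.mem_nhds hyW), not_frequently.1 hn⟩
    filter_upwards [key] with n hn p hp
    by_contra hpU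
    exact hn ⟨p, hp, hpU⟩
  refine ⟨L, hL.isCompact, ?_, hupper, ?_⟩
  · by_contra hne
    obtain ⟨n, hn⟩ := (hupper ∅ isOpen_empty (not_nonempty_iff_eq_empty.1 hne).subset).exists
    exact (hA n).ne_empty (subset_empty_iff.1 hn)
  · rintro U hU ⟨x, hxL, hxU⟩
    exact h x hxL U hU hxU

/-- For a free closed topological disk `D`, the sequence of iterates
`(h^n(D))_{n ≥ 0}`, viewed in the one-point compactification `ℝ² ∪ {∞}`, converges in the
Hausdorff topology on nonempty compact subsets. -/
theorem iterates_of_free_disk_converge (h : BrouwerHomeo) (D : Set Plane)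
    (hD : IsClosedDisk D) (hfree : IsFree h D) :
    ∃ L : Set (OnePoint Plane), IsCompact L ∧ L.Nonempty ∧
      HausdorffConvergesTo (fun n : ℕ => OnePoint.some '' (h.iter n '' D)) L := by
  set f := h.toHomeomorph
  have hf : IsotopicToId f := h.orientationPreserving
  have hfix : ∀ p, f p ≠ p := h.fixedPointFree
  obtain ⟨e⟩ := hD
  have hrange : range (fun q => (e.symm q : Plane)) = D := by
    rw [← Function.comp_def, range_comp, e.symm.surjective.range_eq, image_univ, Subtype.range_coe]
  have hcont : Continuous fun q => (e.symm q : Plane) :=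
    continuous_subtype_val.comp e.symm.continuous
  have hDc : IsCompact D := by
    have : CompactSpace (closedBall (0 : Plane) 1) :=
      isCompact_iff_compactSpace.1 (isCompact_closedBall _ _)
    exact hrange ▸ isCompact_range hcont
  have hDp : IsPreconnected D := by
    have : PreconnectedSpace (closedBall (0 : Plane) 1) :=
      Subtype.preconnectedSpace (convex_closedBall _ _).isPreconnected
    exact hrange ▸ isPreconnected_range hcont
  have hDne : D.Nonempty := ⟨_, (e.symm ⟨0, mem_closedBall_self zero_le_one⟩).2⟩
  have hDfree : ∀ p ∈ D, f p ∉ D := fun p hp =>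
    Set.disjoint_left.1 hfree (mem_image_of_mem f hp)
  simp only [BrouwerHomeo.iter_natCast]
  refine exists_hausdorffConvergesTo (fun n => (hDne.image _).image _) fun x hx U hU hxU => ?_
  have hmeet : ∀ (n : ℕ) (W : Set Plane), (f^[n] '' D ∩ W).Nonempty →
      OnePoint.some '' W ⊆ U → (OnePoint.some '' (f^[n] '' D) ∩ U).Nonempty := by
    rintro n W ⟨p, hp, hpW⟩ hWU
    exact ⟨p, mem_image_of_mem _ hp, hWU (mem_image_of_mem _ hpW)⟩
  induction x using OnePoint.rec with
  | infty =>
    obtain ⟨d, hd⟩ := hDne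
    filter_upwards [hf.eventually_notMem hfix ((OnePoint.isOpen_iff_of_mem' hxU).1 hU).1 d]
      with n hn
    exact ⟨_, mem_image_of_mem _ (mem_image_of_mem _ hd), not_not.1 hn⟩
  | coe x =>
    obtain ⟨R, hR, hRfree, -⟩ := exists_critical_ball (hfix x)
    obtain ⟨ε, hε, hεU⟩ := Metric.isOpen_iff.1 (hU.preimage OnePoint.continuous_coe) x hxU
    obtain ⟨r, hr, hrm⟩ := exists_between (lt_min hR hε)
    have hrR : closedBall x r ⊆ ball x R := closedBall_subset_ball (hrm.trans_le (min_le_left _ _))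
    have hrU : closedBall x r ⊆ ball x ε := closedBall_subset_ball (hrm.trans_le (min_le_right _ _))
    have hfreq : ∃ᶠ n in atTop, (f^[n] '' D ∩ closedBall x r).Nonempty := by
      refine (hx (OnePoint.some '' ball x r) (OnePoint.isOpen_image_coe.2 isOpen_ball)
        (mem_image_of_mem _ (mem_ball_self hr))).mono ?_
      rintro n ⟨_, ⟨p, hp, rfl⟩, ⟨q, hq, hqp⟩⟩
      obtain rfl := OnePoint.coe_injective hqp
      exact ⟨q, hp, ball_subset_closedBall hq⟩
    obtain ⟨a, ha⟩ := hfreq.exists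
    filter_upwards [eventually_ge_atTop a] with b hab
    obtain ⟨c, hbc, hc⟩ := frequently_atTop.1 hfreq b
    refine hmeet b _ (hf.inter_nonempty_of_between hfix hDc hDp hDfree (isCompact_closedBall x r)
      (convex_closedBall x r).isPreconnected
      (fun p hp hfp => hRfree p (hrR hp) (hrR hfp)) hab hbc ha hc) ?_
    exact image_subset_iff.2 (hrU.trans hεU)
end
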